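/- arXiv:1706.00475 — 3 statements merged into one kernel-verified Lean document; each statement's English description precedes it below -/
import Mathlib

section
/- Let Λ be an artin algebra with global dimension d, and let Q̃ be the direct sum of representatives of isomorphism classes of all indecomposable projective-injective Λ-modules. If X is a finitely generated Λ-module that is both generated and cogenerated by Q̃, then the projective dimension of X is at most d−1 and the injective dimension of X is at most d−1. -/
open Function LinearMap

section Prelim

variable (Λ : Type) [Ring Λ]

/-- A module that is both projective and injective. -/
def IsProjInj (M : Type) [AddCommGroup M] [Module Λ M] : Prop :=
  Module.Projective Λ M ∧ Module.Injective Λ M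

/-- `X` is generated by the projective-injective modules: it is a quotient of a
finitely generated projective-injective module (equivalently, of a finite direct sum of
copies of `Q̃`). -/
def GenByProjInj (X : Type) [AddCommGroup X] [Module Λ X] : Prop :=
  ∃ Q : ModuleCat.{0} Λ, Module.Finite Λ Q ∧ IsProjInj Λ Q ∧
    ∃ f : Q →ₗ[Λ] X, Surjective f

/-- `X` is cogenerated by the projective-injective modules: it embeds into a
finitely generated projective-injective module. -/
def CogenByProjInj (X : Type) [AddCommGroup X] [Module Λ X] : Prop :=
  ∃ Q : ModuleCat.{0} Λ, Module.Finite Λ Q ∧ IsProjInj Λ Q ∧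
    ∃ f : X →ₗ[Λ] Q, Injective f

/-- Membership in `C_Λ = Gen(Q̃) ∩ Cogen(Q̃)`. -/
def MemC (X : Type) [AddCommGroup X] [Module Λ X] : Prop :=
  GenByProjInj Λ X ∧ CogenByProjInj Λ X

/-- `pdLEcat Λ n X` : `X` has projective dimension at most `n`. -/
def pdLEcat : ℕ → ModuleCat.{0} Λ → Prop
  | 0, X => Module.Projective Λ X
  | n+1, X => ∃ (P : ModuleCat.{0} Λ) (g : P →ₗ[Λ] X),
      Module.Projective Λ P ∧ Module.Finite Λ P ∧ Surjective g ∧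
      pdLEcat n (ModuleCat.of Λ (↥(LinearMap.ker g)))

/-- Projective dimension at most `n`, for a bare module. -/
def pdLE (n : ℕ) (X : Type) [AddCommGroup X] [Module Λ X] : Prop :=
  pdLEcat Λ n (ModuleCat.of Λ X)

/-- `idLEcat Λ n X` : `X` has injective dimension at most `n`. -/
def idLEcat : ℕ → ModuleCat.{0} Λ → Prop
  | 0, X => Module.Injective Λ X
  | n+1, X => ∃ (I : ModuleCat.{0} Λ) (f : X →ₗ[Λ] I),
      Module.Injective Λ I ∧ Injective f ∧
      idLEcat n (ModuleCat.of Λ (↥I ⧸ LinearMap.range f))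

/-- Injective dimension at most `n`, for a bare module. -/
def idLE (n : ℕ) (X : Type) [AddCommGroup X] [Module Λ X] : Prop :=
  idLEcat Λ n (ModuleCat.of Λ X)

/-- Global dimension at most `d` (on finitely generated modules). -/
def GlobalDimLE (d : ℕ) : Prop :=
  ∀ X : ModuleCat.{0} Λ, Module.Finite Λ X → pdLEcat Λ d X

/-- Global dimension exactly `d`. -/
def GlobalDimEq (d : ℕ) : Prop :=
  GlobalDimLE Λ d ∧ ∀ m, GlobalDimLE Λ m → d ≤ m

/-- `Ext¹_Λ(Y, X) = 0`, expressed by the splitting of all short exact sequences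
`0 → X → E → Y → 0`. -/
def Ext1Vanish (Y X : Type) [AddCommGroup Y] [Module Λ Y]
    [AddCommGroup X] [Module Λ X] : Prop :=
  ∀ (E : ModuleCat.{0} Λ) (f : X →ₗ[Λ] E) (g : E →ₗ[Λ] Y),
    Injective f → Surjective g → LinearMap.range f = LinearMap.ker g →
    ∃ r : E →ₗ[Λ] X, r ∘ₗ f = LinearMap.id

/-- `M` belongs to `add T`: `M` is a direct summand of a finite direct sum of copies of `T`. -/
def InAddOf (T M : Type) [AddCommGroup T] [Module Λ T]
    [AddCommGroup M] [Module Λ M] : Prop :=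
  ∃ (m : ℕ) (p : (Fin m → T) →ₗ[Λ] M) (s : M →ₗ[Λ] (Fin m → T)),
    p ∘ₗ s = LinearMap.id

/-- A (classical) tilting module. -/
def IsTilting (T : Type) [AddCommGroup T] [Module Λ T] : Prop :=
  pdLE Λ 1 T ∧ Ext1Vanish Λ T T ∧
  ∃ (T0 T1 : ModuleCat.{0} Λ) (f : Λ →ₗ[Λ] T0) (g : T0 →ₗ[Λ] T1),
    InAddOf Λ T T0 ∧ InAddOf Λ T T1 ∧ Injective f ∧ Surjective g ∧
    LinearMap.range f = LinearMap.ker g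

/-- A (classical) cotilting module. -/
def IsCotilting (T : Type) [AddCommGroup T] [Module Λ T] : Prop :=
  idLE Λ 1 T ∧ Ext1Vanish Λ T T ∧
  ∀ (I : ModuleCat.{0} Λ), Module.Finite Λ I → Module.Injective Λ I →
    ∃ (C0 C1 : ModuleCat.{0} Λ) (u : C0 →ₗ[Λ] C1) (v : C1 →ₗ[Λ] I),
      InAddOf Λ T C0 ∧ InAddOf Λ T C1 ∧ Injective u ∧ Surjective v ∧
      LinearMap.range u = LinearMap.ker v

/-- Dominant dimension at least `2`: there is an exact sequence `0 → Λ → Q₀ → Q₁`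
with `Q₀, Q₁` projective-injective. -/
def DomdimGE2 : Prop :=
  ∃ (Q0 Q1 : ModuleCat.{0} Λ) (f : Λ →ₗ[Λ] Q0) (g : Q0 →ₗ[Λ] Q1),
    Module.Finite Λ Q0 ∧ IsProjInj Λ Q0 ∧ Module.Finite Λ Q1 ∧ IsProjInj Λ Q1 ∧
    Injective f ∧ LinearMap.range f = LinearMap.ker g

/-- An indecomposable (nonzero) module: the only idempotent endomorphisms are `0` and `id`. -/
def Indecomposable (M : Type) [AddCommGroup M] [Module Λ M] : Prop :=
  (∃ x : M, x ≠ 0) ∧ ∀ e : M →ₗ[Λ] M, e ∘ₗ e = e → e = 0 ∨ e = LinearMap.id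

/-- A right minimal morphism. -/
def RightMinimal {B C : Type} [AddCommGroup B] [Module Λ B] [AddCommGroup C] [Module Λ C]
    (f : B →ₗ[Λ] C) : Prop :=
  ∀ g : B →ₗ[Λ] B, f ∘ₗ g = f → Bijective g

/-- A left minimal morphism. -/
def LeftMinimal {A B : Type} [AddCommGroup A] [Module Λ A] [AddCommGroup B] [Module Λ B]
    (f : A →ₗ[Λ] B) : Prop :=
  ∀ g : B →ₗ[Λ] B, g ∘ₗ f = f → Bijective g

/-- `f : P → X` is a projective cover: `P` is projective, `f` is surjective and its kernel
is superfluous. -/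
def IsProjCover {P X : Type} [AddCommGroup P] [Module Λ P] [AddCommGroup X] [Module Λ X]
    (f : P →ₗ[Λ] X) : Prop :=
  Module.Projective Λ P ∧ Surjective f ∧
    ∀ N : Submodule Λ P, N ⊔ LinearMap.ker f = ⊤ → N = ⊤

/-- `f : X → I` is an injective envelope: `I` is injective, `f` is injective and its image is
essential. -/
def IsInjEnv {X I : Type} [AddCommGroup X] [Module Λ X] [AddCommGroup I] [Module Λ I]
    (f : X →ₗ[Λ] I) : Prop :=
  Module.Injective Λ I ∧ Injective f ∧
    ∀ N : Submodule Λ I, N ⊓ LinearMap.range f = ⊥ → N = ⊥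

/-- An essential submodule. -/
def IsEssentialSub {M : Type} [AddCommGroup M] [Module Λ M] (N : Submodule Λ M) : Prop :=
  ∀ N' : Submodule Λ M, N ⊓ N' = ⊥ → N' = ⊥

/-- A uniserial module: submodules are totally ordered by inclusion. -/
def Uniserial (M : Type) [AddCommGroup M] [Module Λ M] : Prop :=
  ∀ N₁ N₂ : Submodule Λ M, N₁ ≤ N₂ ∨ N₂ ≤ N₁

/-- The radical of a module: the intersection of its maximal submodules. -/
def radSub (M : Type) [AddCommGroup M] [Module Λ M] : Submodule Λ M :=
  sInf {N : Submodule Λ M | IsCoatom N}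

/-- An almost split (Auslander-Reiten) sequence `0 → A → E → C → 0`. -/
def IsAlmostSplitSeq {A E C : Type} [AddCommGroup A] [Module Λ A]
    [AddCommGroup E] [Module Λ E] [AddCommGroup C] [Module Λ C]
    (f : A →ₗ[Λ] E) (g : E →ₗ[Λ] C) : Prop :=
  Injective f ∧ Surjective g ∧ LinearMap.range f = LinearMap.ker g ∧
  (¬∃ r : E →ₗ[Λ] A, r ∘ₗ f = LinearMap.id) ∧
  Indecomposable Λ A ∧ Indecomposable Λ C ∧
  ∀ (Z : ModuleCat.{0} Λ) (h : Z →ₗ[Λ] C), Module.Finite Λ Z →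
    (¬∃ s : C →ₗ[Λ] Z, h ∘ₗ s = LinearMap.id) → ∃ l : (Z →ₗ[Λ] E), g ∘ₗ l = h

/-- `N` is the Auslander-Reiten translate `τ M` of `M`: writing `M ≅ P ⊕ (⊕ᵢ Cᵢ)` with `P`
projective and `Cᵢ` indecomposable ends of almost split sequences `0 → Aᵢ → Eᵢ → Cᵢ → 0`,
we have `N ≅ ⊕ᵢ Aᵢ`. -/
def IsTauOf (N M : Type) [AddCommGroup N] [Module Λ N] [AddCommGroup M] [Module Λ M] : Prop :=
  ∃ (r : ℕ) (P : ModuleCat.{0} Λ) (A E C : Fin r → ModuleCat.{0} Λ)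
    (f : ∀ i, (A i : Type) →ₗ[Λ] (E i : Type)) (g : ∀ i, (E i : Type) →ₗ[Λ] (C i : Type)),
    Module.Projective Λ P ∧ (∀ i, IsAlmostSplitSeq Λ (f i) (g i)) ∧
    Nonempty (M ≃ₗ[Λ] (Prod (P : Type) ((i : Fin r) → (C i : Type)))) ∧
    Nonempty (N ≃ₗ[Λ] (∀ i, (A i : Type)))

end Prelim

section HomModule

variable {R : Type} [Ring R] {T M : Type} [AddCommGroup T] [Module R T]
  [AddCommGroup M] [Module R M]

/-- `Hom_R(T, M)` as a left module over `B = End_R(T)ᵒᵖ`, via precomposition. -/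
instance instSMulHomEndOp : SMul (Module.End R T)ᵐᵒᵖ (T →ₗ[R] M) :=
  ⟨fun b f => f ∘ₗ b.unop⟩

lemma endOp_smul_def (b : (Module.End R T)ᵐᵒᵖ) (f : T →ₗ[R] M) :
    b • f = f ∘ₗ b.unop := rfl

instance instMulActionHomEndOp : MulAction (Module.End R T)ᵐᵒᵖ (T →ₗ[R] M) where
  one_smul f := by ext x; rfl
  mul_smul b c f := by ext x; rfl

instance instDistribMulActionHomEndOp :
    DistribMulAction (Module.End R T)ᵐᵒᵖ (T →ₗ[R] M) where
  smul_zero b := by ext x; rfl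
  smul_add b f g := by ext x; rfl

instance instModuleHomEndOp : Module (Module.End R T)ᵐᵒᵖ (T →ₗ[R] M) where
  add_smul b c f := by ext x; simp [endOp_smul_def]
  zero_smul f := by ext x; simp [endOp_smul_def]

end HomModule
section Aux

open CategoryTheory CategoryTheory.Abelian

variable {Λ : Type} [Ring Λ]

lemma aux_shortExact_quot {A B : Type} [AddCommGroup A] [Module Λ A] [AddCommGroup B] [Module Λ B]
    (f : A →ₗ[Λ] B) (hf : Function.Injective f) :
    (ModuleCat.shortComplexOfCompEqZero _ _
      f.exact_map_mkQ_range.linearMap_comp_eq_zero).ShortExact :=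
  ModuleCat.shortComplex_shortExact _ f.exact_map_mkQ_range hf (Submodule.mkQ_surjective _)

lemma aux_pd_to (n : ℕ) (X : ModuleCat.{0} Λ) (h : pdLEcat Λ n X) :
    HasProjectiveDimensionLT X (n + 1) := by
  induction n generalizing X with
  | zero =>
    have : Module.Projective Λ X := h
    infer_instance
  | succ n ih =>
    obtain ⟨P, g, hP, -, hg, hk⟩ := h
    have hS := LinearMap.shortExact_shortComplexKer hg
    exact hS.hasProjectiveDimensionLT_X₃ (n + 1) (ih _ hk)
      (by
        have : HasProjectiveDimensionLT P 1 := inferInstance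
        exact hasProjectiveDimensionLT_of_ge P 1 _ (by omega))

lemma aux_pd_from [IsNoetherianRing Λ] (n : ℕ) (X : ModuleCat.{0} Λ) [Module.Finite Λ X]
    (h : HasProjectiveDimensionLT X (n + 1)) : pdLEcat Λ n X := by
  induction n generalizing X with
  | zero =>
    have : CategoryTheory.Projective X := projective_iff_hasProjectiveDimensionLT_one.2 h
    exact (IsProjective.iff_projective (R := Λ) X).2 this
  | succ n ih =>
    obtain ⟨m, g, hg⟩ := Module.Finite.exists_fin' Λ X
    refine ⟨ModuleCat.of Λ (Fin m → Λ), g, ?_, ?_, hg, ?_⟩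
    · exact inferInstanceAs (Module.Projective Λ (Fin m → Λ))
    · exact inferInstanceAs (Module.Finite Λ (Fin m → Λ))
    · have hS := LinearMap.shortExact_shortComplexKer hg
      have : Module.Finite Λ (ModuleCat.of Λ (LinearMap.ker g)) :=
        inferInstanceAs (Module.Finite Λ (LinearMap.ker g))
      refine ih (ModuleCat.of Λ (LinearMap.ker g)) ?_
      refine hS.hasProjectiveDimensionLT_X₁ (n + 1) ?_ h
      have : HasProjectiveDimensionLT (ModuleCat.of Λ (Fin m → Λ)) 1 := inferInstance
      exact hasProjectiveDimensionLT_of_ge (ModuleCat.of Λ (Fin m → Λ)) 1 _ (by omega)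

lemma aux_id_from (n : ℕ) (X : ModuleCat.{0} Λ)
    (h : ∀ (I : Ideal Λ) (e : Ext.{0} (ModuleCat.of Λ (Λ ⧸ I)) X (n + 1)), e = 0) :
    idLEcat Λ n X := by
  induction n generalizing X with
  | zero =>
    refine Module.Baer.injective ?_
    intro I g
    have hS := aux_shortExact_quot (Λ := Λ) I.subtype I.injective_subtype
    have h0 : ∀ e : Ext.{0} (ModuleCat.of Λ (Λ ⧸ LinearMap.range I.subtype)) X 1, e = 0 := by
      rw [Submodule.range_subtype]
      exact h I
    obtain ⟨φ, hφ⟩ := Ext.contravariant_sequence_exact₁ hS X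
      (Ext.mk₀ (ModuleCat.ofHom g)) (add_zero 1) (h0 _)
    obtain ⟨φ, rfl⟩ := Ext.homEquiv₀.symm.surjective φ
    have key : ModuleCat.ofHom I.subtype ≫ φ = ModuleCat.ofHom g :=
      Ext.homEquiv₀.symm.injective (by simpa using hφ)
    refine ⟨φ.hom, fun x hx => ?_⟩
    have := congrArg (fun t => t.hom ⟨x, hx⟩) key
    exact this
  | succ n ih =>
    obtain ⟨J, hJ, f, hf⟩ := EnoughInjectives.presentation X
    have hinj : Function.Injective f.hom := (ModuleCat.mono_iff_injective f).mp hf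
    refine ⟨J, f.hom, (Module.injective_iff_injective_object Λ J).2 hJ, hinj, ?_⟩
    have hS := aux_shortExact_quot f.hom hinj
    refine ih _ fun I e => ?_
    obtain ⟨x₂, hx⟩ := Ext.covariant_sequence_exact₃ _ hS e rfl (h I _)
    rw [← hx]
    have : x₂ = 0 := Ext.eq_zero_of_injective (I := J) x₂
    rw [this, Ext.zero_comp]

end Aux

theorem stmt0 (Λ : Type) [Ring Λ] (k : Type) [CommRing k] [IsArtinianRing k] [Algebra k Λ]
    [Module.Finite k Λ]
    (d : ℕ) (hgl : GlobalDimEq Λ d)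
    (X : Type) [AddCommGroup X] [Module Λ X] [Module.Finite Λ X]
    (hX : MemC Λ X) :
    pdLE Λ (d - 1) X ∧ idLE Λ (d - 1) X := by
  have hk : IsNoetherianRing k := inferInstance
  have hΛk : IsNoetherian k Λ := isNoetherian_of_isNoetherianRing_of_finite k Λ
  have hN : IsNoetherianRing Λ := isNoetherian_of_tower k hΛk
  have hfin : ∀ (n : ℕ) (I : Ideal Λ) (Y : ModuleCat.{0} Λ)
      (e : CategoryTheory.Abelian.Ext.{0} (ModuleCat.of Λ (Λ ⧸ I)) Y (d + 1)), e = 0 := by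
    intro n I Y e
    have : Module.Finite Λ (ModuleCat.of Λ (Λ ⧸ I)) := inferInstanceAs (Module.Finite Λ (Λ ⧸ I))
    have := aux_pd_to d (ModuleCat.of Λ (Λ ⧸ I)) (hgl.1 _ this)
    exact e.eq_zero_of_hasProjectiveDimensionLT (d + 1) le_rfl
  have hXf : Module.Finite Λ (ModuleCat.of Λ X) := inferInstanceAs (Module.Finite Λ X)
  cases d with
  | zero =>
    exact ⟨hgl.1 _ hXf, aux_id_from 0 _ fun I e => hfin 0 I _ e⟩
  | succ d =>
    obtain ⟨⟨Q, hQf, ⟨hQp, hQi⟩, p, hp⟩, ⟨Q', hQf', ⟨hQp', hQi'⟩, i, hi⟩⟩ := hX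
    constructor
    · refine aux_pd_from d _ ?_
      have hS := aux_shortExact_quot i hi
      have hF : Module.Finite Λ (ModuleCat.of Λ (Q' ⧸ LinearMap.range i)) :=
        inferInstanceAs (Module.Finite Λ (Q' ⧸ LinearMap.range i))
      refine hS.hasProjectiveDimensionLT_X₁ (d + 1) ?_ (aux_pd_to (d + 1) _ (hgl.1 _ hF))
      have : CategoryTheory.HasProjectiveDimensionLT Q' 1 := inferInstance
      exact CategoryTheory.hasProjectiveDimensionLT_of_ge Q' 1 _ (by omega)
    · refine aux_id_from d _ fun I e => ?_
      have hS := LinearMap.shortExact_shortComplexKer hp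
      obtain ⟨x₂, hx⟩ := CategoryTheory.Abelian.Ext.covariant_sequence_exact₃ _ hS e rfl
        (hfin 0 I _ _)
      rw [← hx]
      have hQc : CategoryTheory.Injective Q := (Module.injective_iff_injective_object Λ Q).1 hQi
      have : x₂ = 0 := CategoryTheory.Abelian.Ext.eq_zero_of_injective (I := Q) x₂
      rw [this, CategoryTheory.Abelian.Ext.zero_comp]
end

section
/- Let Λ be an artin algebra with n non-isomorphic simple modules, and let {X_i}_{i∈I} be a family of pairwise non-isomorphic indecomposable Λ-modules such that each X_i has projective dimension exactly 1 and Ext¹_Λ(X_i, X_j) = 0 for all i, j. Then the index set I is finite with at most n elements. -/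
open Function LinearMap

set_option linter.unusedSectionVars false
namespace Stmt8Aux

variable {Λ : Type} [Ring Λ] {k : Type} [CommRing k] [Algebra k Λ]

section Hom
variable (k)
variable {P P' : Type} [AddCommGroup P] [Module Λ P] [AddCommGroup P'] [Module Λ P']
variable {A B C : Type} [AddCommGroup A] [Module Λ A] [Module k A] [IsScalarTower k Λ A]
  [AddCommGroup B] [Module Λ B] [Module k B] [IsScalarTower k Λ B]
  [AddCommGroup C] [Module Λ C] [Module k C] [IsScalarTower k Λ C]

/-- post-composition -/
def postc (P : Type) [AddCommGroup P] [Module Λ P] (f : A →ₗ[Λ] B) :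
    (P →ₗ[Λ] A) →ₗ[k] (P →ₗ[Λ] B) where
  toFun h := f ∘ₗ h
  map_add' x y := by ext; simp
  map_smul' c x := by
    ext p
    simp only [LinearMap.comp_apply, LinearMap.smul_apply, RingHom.id_apply]
    exact (f.restrictScalars k).map_smul c (x p)

/-- pre-composition -/
def prec (A : Type) [AddCommGroup A] [Module Λ A] [Module k A] [IsScalarTower k Λ A]
    (f : P →ₗ[Λ] P') : (P' →ₗ[Λ] A) →ₗ[k] (P →ₗ[Λ] A) where
  toFun h := h ∘ₗ f
  map_add' x y := by ext; simp
  map_smul' c x := by ext p; simp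

/-- length of the Hom module -/
noncomputable def hl (P A : Type) [AddCommGroup P] [Module Λ P]
    [AddCommGroup A] [Module Λ A] [Module k A] [IsScalarTower k Λ A] : ℕ :=
  (Module.length k (P →ₗ[Λ] A)).toNat

variable [IsArtinianRing k]

lemma hom_finite [Module.Finite k Λ] (P A : Type) [AddCommGroup P] [Module Λ P]
    [AddCommGroup A] [Module Λ A] [Module k A] [IsScalarTower k Λ A]
    [Module.Finite Λ P] [Module.Finite Λ A] : Module.Finite k (P →ₗ[Λ] A) := by
  have : Module.Finite k A := Module.Finite.trans Λ A
  obtain ⟨m, f, hf⟩ := Module.Finite.exists_fin' Λ P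
  have h1 : Module.Finite k ((Fin m → Λ) →ₗ[Λ] A) := by
    let ev : ((Fin m → Λ) →ₗ[Λ] A) →ₗ[k] (Fin m → A) :=
      { toFun := fun h i => h (Pi.single i 1)
        map_add' := by intros; ext; simp
        map_smul' := by intros; ext; simp }
    refine Module.Finite.of_injective ev ?_
    intro x y hxy
    refine LinearMap.pi_ext' fun i => LinearMap.ext_ring ?_
    exact congrFun hxy i
  refine Module.Finite.of_injective (prec k A f) ?_
  intro x y hxy
  ext p
  obtain ⟨q, rfl⟩ := hf p
  exact LinearMap.congr_fun hxy q

variable [Module.Finite k Λ]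

lemma hl_coe (P A : Type) [AddCommGroup P] [Module Λ P]
    [AddCommGroup A] [Module Λ A] [Module k A] [IsScalarTower k Λ A]
    [Module.Finite Λ P] [Module.Finite Λ A] :
    (hl (Λ := Λ) k P A : ℕ∞) = Module.length k (P →ₗ[Λ] A) := by
  have := hom_finite (Λ := Λ) k P A
  exact ENat.natCast_toNat Module.length_ne_top

lemma hl_eq_zero [Module.Finite Λ P] [Module.Finite Λ A] (h : hl (Λ := Λ) k P A = 0)
    (f : P →ₗ[Λ] A) : f = 0 := by
  have h1 := hl_coe (Λ := Λ) k P A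
  rw [h] at h1
  have := Module.length_eq_zero_iff.1 h1.symm
  exact Subsingleton.elim _ _

lemma hl_zero_of (h : ∀ f : P →ₗ[Λ] A, f = 0) : hl (Λ := Λ) k P A = 0 := by
  have : Subsingleton (P →ₗ[Λ] A) := ⟨fun a b => by rw [h a, h b]⟩
  simp [hl]

lemma exact_aux (f : A →ₗ[Λ] B) (g : B →ₗ[Λ] C) (hf : Injective f)
    (hfg : LinearMap.range f = LinearMap.ker g) (h : P →ₗ[Λ] B) (hh : g ∘ₗ h = 0) :
    ∃ h' : P →ₗ[Λ] A, f ∘ₗ h' = h := by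
  have hr : ∀ p, h p ∈ LinearMap.range f := fun p => by
    rw [hfg]; exact LinearMap.congr_fun hh p
  refine ⟨(LinearEquiv.ofInjective f hf).symm.toLinearMap ∘ₗ h.codRestrict _ hr, ?_⟩
  ext p
  have := LinearEquiv.apply_symm_apply (LinearEquiv.ofInjective f hf) ⟨h p, hr p⟩
  exact congrArg Subtype.val this

variable [Module.Finite Λ P] [Module.Finite Λ A] [Module.Finite Λ B] [Module.Finite Λ C]

lemma hl_exact (P : Type) [AddCommGroup P] [Module Λ P] [Module.Finite Λ P]
    (f : A →ₗ[Λ] B) (g : B →ₗ[Λ] C) (hf : Injective f)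
    (hfg : LinearMap.range f = LinearMap.ker g)
    (hlift : ∀ h : P →ₗ[Λ] C, ∃ h', g ∘ₗ h' = h) :
    hl (Λ := Λ) k P B = hl (Λ := Λ) k P A + hl (Λ := Λ) k P C := by
  have := Module.length_eq_add_of_exact (postc k P f) (postc k P g)
    (fun x y hxy => by
      ext p; exact hf (LinearMap.congr_fun hxy p)) hlift
    (by
      intro h
      constructor
      · intro hh; exact exact_aux f g hf hfg h hh
      · rintro ⟨h', rfl⟩
        ext p
        have : f (h' p) ∈ LinearMap.ker g := hfg ▸ LinearMap.mem_range_self f _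
        exact this)
  rw [← hl_coe, ← hl_coe, ← hl_coe] at this
  exact_mod_cast this

lemma hl_exact_le (P : Type) [AddCommGroup P] [Module Λ P] [Module.Finite Λ P]
    (f : A →ₗ[Λ] B) (g : B →ₗ[Λ] C) (hf : Injective f)
    (hfg : LinearMap.range f = LinearMap.ker g) :
    hl (Λ := Λ) k P B ≤ hl (Λ := Λ) k P A + hl (Λ := Λ) k P C ∧
    (hl (Λ := Λ) k P A + hl (Λ := Λ) k P C ≤ hl (Λ := Λ) k P B →
      ∀ h : P →ₗ[Λ] C, ∃ h', g ∘ₗ h' = h) := by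
  have := Module.length_eq_add_of_exact (postc k P f) (postc k P g).rangeRestrict
    (fun x y hxy => by
      ext p; exact hf (LinearMap.congr_fun hxy p)) (LinearMap.surjective_rangeRestrict _)
    (by
      intro h
      constructor
      · intro hh; exact exact_aux f g hf hfg h (congrArg Subtype.val hh)
      · rintro ⟨h', rfl⟩
        apply Subtype.ext
        ext p
        have : f (h' p) ∈ LinearMap.ker g := hfg ▸ LinearMap.mem_range_self f _
        exact this)
  have hfin := hom_finite (Λ := Λ) k P C
  have h1 : Module.length k (LinearMap.range (postc k P g)) ≤ Module.length k (P →ₗ[Λ] C) :=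
    Module.length_le_of_injective _ (Submodule.injective_subtype _)
  constructor
  · rw [← hl_coe, ← hl_coe] at this
    rw [← hl_coe] at h1
    have h2 := add_le_add_right h1 (hl (Λ := Λ) k P A : ℕ∞)
    rw [← this] at h2
    exact_mod_cast h2
  · intro hle h
    by_contra hne
    have h3 : LinearMap.range (postc k P g) ≠ ⊤ := by
      intro htop
      have : h ∈ LinearMap.range (postc k P g) := htop ▸ Submodule.mem_top
      obtain ⟨h', e⟩ := this
      exact hne ⟨h', e⟩
    have h4 := Submodule.length_lt h3
    have h5 : Module.length k (LinearMap.range (postc k P g)) ≠ ⊤ := ne_top_of_lt h4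
    obtain ⟨r, hr⟩ := ENat.ne_top_iff_exists.1 h5
    rw [← hr, ← hl_coe] at h4
    rw [← hr, ← hl_coe, ← hl_coe] at this
    have h6 : r < hl (Λ := Λ) k P C := by exact_mod_cast h4
    have h7 : hl (Λ := Λ) k P B = hl (Λ := Λ) k P A + r := by exact_mod_cast this
    omega

lemma hl_congr (P : Type) [AddCommGroup P] [Module Λ P] (e : A ≃ₗ[Λ] B) :
    hl (Λ := Λ) k P A = hl (Λ := Λ) k P B := by
  have e' : (P →ₗ[Λ] A) ≃ₗ[k] (P →ₗ[Λ] B) := LinearEquiv.ofLinearMap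
    (postc k P e.toLinearMap) (postc k P e.symm.toLinearMap)
    (by ext h p; simp [postc]) (by ext h p; simp [postc])
  simp [hl, e'.length_eq]

lemma hl_of_factor (P : Type) [AddCommGroup P] [Module Λ P] (f : A →ₗ[Λ] B) (hf : Injective f)
    (h : ∀ h : P →ₗ[Λ] B, ∃ h', f ∘ₗ h' = h) :
    hl (Λ := Λ) k P A = hl (Λ := Λ) k P B := by
  have e' : (P →ₗ[Λ] A) ≃ₗ[k] (P →ₗ[Λ] B) := LinearEquiv.ofBijective
    (postc k P f) ⟨fun x y hxy => by
      ext p; exact hf (LinearMap.congr_fun hxy p), h⟩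
  simp [hl, e'.length_eq]

/-- every map `ker g → Z` extends. -/
def ExtOk {P M : Type} [AddCommGroup P] [Module Λ P] [AddCommGroup M] [Module Λ M]
    (g : P →ₗ[Λ] M) (Z : Type) [AddCommGroup Z] [Module Λ Z] : Prop :=
  ∀ φ : LinearMap.ker g →ₗ[Λ] Z, ∃ ψ : P →ₗ[Λ] Z, ψ ∘ₗ (LinearMap.ker g).subtype = φ

lemma factor_aux {P M Z : Type} [AddCommGroup P] [Module Λ P] [AddCommGroup M] [Module Λ M]
    [AddCommGroup Z] [Module Λ Z]
    (g : P →ₗ[Λ] M) (hg : Surjective g) (h : P →ₗ[Λ] Z)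
    (hh : ∀ x ∈ LinearMap.ker g, h x = 0) : ∃ h' : M →ₗ[Λ] Z, h' ∘ₗ g = h := by
  refine ⟨(LinearMap.ker g).liftQ h hh ∘ₗ (g.quotKerEquivOfSurjective hg).symm.toLinearMap, ?_⟩
  ext p
  have : (g.quotKerEquivOfSurjective hg).symm (g p) = Submodule.Quotient.mk p := by
    rw [LinearEquiv.symm_apply_eq]; rfl
  simp only [LinearMap.comp_apply, LinearEquiv.coe_coe, this]
  rfl

lemma hl_pres (g : P →ₗ[Λ] P') (hg : Surjective g) [Module.Finite Λ P']
    [Module.Finite Λ (LinearMap.ker g)] (hE : ExtOk g A) :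
    hl (Λ := Λ) k P A = hl (Λ := Λ) k P' A + hl (Λ := Λ) k (LinearMap.ker g) A := by
  have := Module.length_eq_add_of_exact (prec k A g) (prec k A (LinearMap.ker g).subtype)
    (fun x y hxy => by
      ext p
      obtain ⟨q, rfl⟩ := hg p
      exact LinearMap.congr_fun hxy q) hE
    (by
      intro h
      constructor
      · intro hh
        obtain ⟨h', e⟩ := factor_aux g hg h (fun x hx => LinearMap.congr_fun hh ⟨x, hx⟩)
        exact ⟨h', e⟩
      · rintro ⟨h', rfl⟩
        ext p
        simp [prec])
  rw [← hl_coe, ← hl_coe, ← hl_coe] at this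
  exact_mod_cast this

end Hom

section Ext
variable {P M : Type} [AddCommGroup P] [Module Λ P] [AddCommGroup M] [Module Λ M]

lemma extOk_of_vanish (g : P →ₗ[Λ] M) (hg : Surjective g) (Z : Type) [AddCommGroup Z] [Module Λ Z]
    (h : Ext1Vanish Λ M Z) : ExtOk g Z := by
  intro φ
  let W : Submodule Λ (Z × P) := LinearMap.range (φ.prod (-(LinearMap.ker g).subtype))
  let f : Z →ₗ[Λ] (Z × P) ⧸ W := W.mkQ ∘ₗ LinearMap.inl Λ Z P
  have hW : W ≤ LinearMap.ker (g ∘ₗ LinearMap.snd Λ Z P) := by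
    rintro _ ⟨x, rfl⟩
    simp
  let q : ((Z × P) ⧸ W) →ₗ[Λ] M := W.liftQ (g ∘ₗ LinearMap.snd Λ Z P) hW
  have h_inj : Injective f := by
    rw [← LinearMap.ker_eq_bot, LinearMap.ker_eq_bot']
    intro z hz
    have hz' : ((z, 0) : Z × P) ∈ W := by
      rw [← Submodule.ker_mkQ W]; exact hz
    obtain ⟨x, hx⟩ := hz'
    have h2 : x = 0 := by
      have := congrArg Prod.snd hx
      simpa using this
    have := congrArg Prod.fst hx
    simpa [h2] using this.symm
  have h_sur : Surjective q := by
    intro m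
    obtain ⟨p, rfl⟩ := hg m
    exact ⟨W.mkQ (0, p), rfl⟩
  have h_ex : LinearMap.range f = LinearMap.ker q := by
    apply le_antisymm
    · rintro _ ⟨z, rfl⟩
      change q (W.mkQ (z, 0)) = 0
      simp [q]
    · intro y hy
      obtain ⟨⟨z, p⟩, rfl⟩ := W.mkQ_surjective y
      have hp : g p = 0 := hy
      refine ⟨z + φ ⟨p, hp⟩, ?_⟩
      change W.mkQ _ = W.mkQ _
      rw [← sub_eq_zero, ← map_sub, ← LinearMap.mem_ker, Submodule.ker_mkQ]
      refine ⟨⟨p, hp⟩, ?_⟩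
      simp
  obtain ⟨r, hr⟩ := h (ModuleCat.of Λ ((Z × P) ⧸ W)) f q h_inj h_sur h_ex
  have hmain : ∃ ψ : P →ₗ[Λ] Z, ψ ∘ₗ (LinearMap.ker g).subtype = φ := by
    refine ⟨r ∘ₗ W.mkQ ∘ₗ LinearMap.inr Λ Z P, ?_⟩
    ext x
    have e : W.mkQ ((0 : Z), (x : P)) = f (φ x) := by
      rw [← sub_eq_zero]
      simp only [f, LinearMap.comp_apply, ← map_sub]
      rw [← LinearMap.mem_ker, Submodule.ker_mkQ]
      refine ⟨-x, ?_⟩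
      simp
    have := LinearMap.congr_fun hr (φ x)
    simp only [LinearMap.comp_apply, LinearMap.inr_apply, Submodule.subtype_apply]
    erw [e]
    exact this
  exact hmain

lemma extOk_quot (g : P →ₗ[Λ] M) [Module.Projective Λ (LinearMap.ker g)]
    {Z Z' : Type} [AddCommGroup Z] [Module Λ Z] [AddCommGroup Z'] [Module Λ Z']
    (f : Z →ₗ[Λ] Z') (hf : Surjective f) (h : ExtOk g Z) : ExtOk g Z' := by
  intro φ
  obtain ⟨φ', rfl⟩ := Module.projective_lifting_property f φ hf
  obtain ⟨ψ, hψ⟩ := h φ'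
  exact ⟨f ∘ₗ ψ, by rw [LinearMap.comp_assoc, hψ]⟩

lemma extOk_pi (g : P →ₗ[Λ] M) {τ : Type} (Z : τ → Type) [∀ t, AddCommGroup (Z t)]
    [∀ t, Module Λ (Z t)] (h : ∀ t, ExtOk g (Z t)) : ExtOk g (∀ t, Z t) := by
  intro φ
  choose ψ hψ using fun t => h t (LinearMap.proj t ∘ₗ φ)
  refine ⟨LinearMap.pi ψ, ?_⟩
  ext x t
  exact LinearMap.congr_fun (hψ t) x

/-- lifting along `B → C` when the kernel is Ext-orthogonal -/
lemma extOk_lift (g : P →ₗ[Λ] M) (hg : Surjective g) [Module.Projective Λ P]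
    {A B C : Type} [AddCommGroup A] [Module Λ A] [AddCommGroup B] [Module Λ B]
    [AddCommGroup C] [Module Λ C] (u : A →ₗ[Λ] B) (v : B →ₗ[Λ] C) (hu : Injective u)
    (hv : Surjective v) (huv : LinearMap.range u = LinearMap.ker v) (hE : ExtOk g A)
    (h : M →ₗ[Λ] C) : ∃ h' : M →ₗ[Λ] B, v ∘ₗ h' = h := by
  obtain ⟨l, hl⟩ := Module.projective_lifting_property v (h ∘ₗ g) hv
  obtain ⟨φ, hφ⟩ := exact_aux u v hu huv (l ∘ₗ (LinearMap.ker g).subtype) (by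
    ext x
    have := LinearMap.congr_fun hl (x : P)
    simpa using this)
  obtain ⟨ψ, hψ⟩ := hE φ
  obtain ⟨h', hh'⟩ := factor_aux g hg (l - u ∘ₗ ψ) (by
    intro x hx
    have h1 := LinearMap.congr_fun hφ ⟨x, hx⟩
    have h2 := LinearMap.congr_fun hψ ⟨x, hx⟩
    simp only [LinearMap.comp_apply, Submodule.subtype_apply] at h1 h2
    simp [h2, h1])
  refine ⟨h', ?_⟩
  ext m
  obtain ⟨p, rfl⟩ := hg m
  have h1 := LinearMap.congr_fun hh' p
  have h2 := LinearMap.congr_fun hl p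
  have h3 : v (u (ψ p)) = 0 := by
    have : u (ψ p) ∈ LinearMap.ker v := huv ▸ LinearMap.mem_range_self u _
    exact this
  simp only [LinearMap.comp_apply, LinearMap.sub_apply] at h1 h2 ⊢
  rw [h1, map_sub, h3, h2, sub_zero]

end Ext

section Local
variable {M M' : Type} [AddCommGroup M] [Module Λ M] [AddCommGroup M'] [Module Λ M']

lemma isLocal_end [IsNoetherian Λ M] [IsArtinian Λ M] (h : Indecomposable Λ M) :
    IsLocalRing (Module.End Λ M) := by
  have : Nontrivial M := by
    obtain ⟨x, hx⟩ := h.1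
    exact ⟨x, 0, hx⟩
  have key : ∀ f : Module.End Λ M, IsUnit f ∨ IsNilpotent f := by
    intro f
    obtain ⟨n, hn, hn1⟩ := (f.eventually_isCompl_ker_pow_range_pow.and
      (Filter.eventually_ge_atTop 1)).exists
    have hid := h.2 (Submodule.projection _ _ hn) (Submodule.isIdempotentElem_projection hn)
    rcases hid with h0 | h1
    · left
      have hk : LinearMap.ker (f ^ n) = ⊥ := by
        rw [← Submodule.range_projection hn, h0, LinearMap.range_zero]
      have hr : LinearMap.range (f ^ n) = ⊤ := by
        rw [← Submodule.ker_projection hn, h0, LinearMap.ker_zero]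
      have hu : IsUnit (f ^ n) := (Module.End.isUnit_iff _).2
        ⟨LinearMap.ker_eq_bot.1 hk, LinearMap.range_eq_top.1 hr⟩
      exact (isUnit_pow_iff (by omega)).1 hu
    · right
      refine ⟨n, ?_⟩
      have hr : LinearMap.range (f ^ n) = ⊥ := by
        rw [← Submodule.ker_projection hn, h1, LinearMap.ker_id]
      exact LinearMap.range_eq_bot.1 hr
  refine IsLocalRing.of_isUnit_or_isUnit_one_sub_self fun a => ?_
  rcases key a with h | h
  · exact Or.inl h
  · exact Or.inr h.isUnit_one_sub

lemma equiv_of_retract (hM : Indecomposable Λ M) (hM' : Indecomposable Λ M')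
    (u : M →ₗ[Λ] M') (v : M' →ₗ[Λ] M) (h : IsUnit (v ∘ₗ u : Module.End Λ M)) :
    Nonempty (M ≃ₗ[Λ] M') := by
  obtain ⟨w, hw1, hw2⟩ := isUnit_iff_exists.1 h
  have e1 : ∀ x, v (u (w x)) = x := fun x => LinearMap.congr_fun hw1 x
  have e2 : ∀ x, w (v (u x)) = x := fun x => LinearMap.congr_fun hw2 x
  rcases hM'.2 (u ∘ₗ w ∘ₗ v) (by ext x; simp [e1]) with h0 | h1
  · exfalso
    obtain ⟨x, hx⟩ := hM.1
    apply hx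
    have := LinearMap.congr_fun h0 (u x)
    simp only [LinearMap.comp_apply, e2, LinearMap.zero_apply] at this
    rw [← e2 x, this]; simp
  · exact ⟨LinearEquiv.ofLinearMap u (w ∘ₗ v) h1 (by ext x; simp [e2])⟩

end Local

section Family
variable (k) [IsArtinianRing k] [Module.Finite k Λ]
variable {ι : Type} (X : ι → Type) [∀ i, AddCommGroup (X i)] [∀ i, Module Λ (X i)]
  [∀ i, Module k (X i)] [∀ i, IsScalarTower k Λ (X i)] [∀ i, Module.Finite Λ (X i)]

lemma exists_univ (B : Finset ι) (Z : Type) [AddCommGroup Z] [Module Λ Z] [Module k Z]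
    [IsScalarTower k Λ Z] [Module.Finite Λ Z] :
    ∃ (τ : Type) (_ : Fintype τ) (c : τ → ι) (F : (∀ t, X (c t)) →ₗ[Λ] Z),
      (∀ t, c t ∈ B) ∧ ∀ j ∈ B, ∀ h : X j →ₗ[Λ] Z, ∃ h', F ∘ₗ h' = h := by
  classical
  have hfin : ∀ j, Module.Finite k (X j →ₗ[Λ] Z) := fun j => hom_finite k _ _
  choose m e he using fun j => Module.Finite.exists_fin (R := k) (M := X j →ₗ[Λ] Z)
  let τ : Type := Σ j : B, Fin (m j)
  let F : (∀ t : τ, X t.1) →ₗ[Λ] Z := ∑ t : τ, e t.1 t.2 ∘ₗ LinearMap.proj t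
  refine ⟨τ, inferInstance, fun t => t.1, F, fun t => t.1.2, ?_⟩
  intro j hj h
  have hle : Submodule.span k (Set.range (e j)) ≤ LinearMap.range (postc k (X j) F) := by
    rw [Submodule.span_le]
    rintro _ ⟨a, rfl⟩
    let t : τ := ⟨⟨j, hj⟩, a⟩
    refine ⟨LinearMap.single Λ (fun t : τ => X t.1) t, ?_⟩
    ext x
    simp only [postc, F, LinearMap.coe_mk, AddHom.coe_mk, LinearMap.comp_apply,
      LinearMap.sum_apply]
    rw [Finset.sum_eq_single t]
    · simp [t]
    · intro b _ hb
      simp [Pi.single_eq_of_ne hb]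
    · simp
  rw [he] at hle
  exact hle (Submodule.mem_top (x := h))

variable {P : ι → Type} [∀ i, AddCommGroup (P i)] [∀ i, Module Λ (P i)]
  [∀ i, Module.Finite Λ (P i)] [∀ i, Module.Projective Λ (P i)]
  (g : ∀ i, P i →ₗ[Λ] X i)
  [∀ i, Module.Projective Λ (LinearMap.ker (g i))]

lemma key_false (hg : ∀ i, Surjective (g i)) (hXind : ∀ i, Indecomposable Λ (X i))
    (hXne : ∀ i j, i ≠ j → IsEmpty (X i ≃ₗ[Λ] X j))
    (hE : ∀ i j, ExtOk (g i) (X j)) (s : Finset ι) (c : ι → ℤ)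
    (hsum : ∀ (Z : Type) [AddCommGroup Z] [Module Λ Z] [Module k Z] [IsScalarTower k Λ Z]
      [Module.Finite Λ Z], (∀ i, ExtOk (g i) Z) →
      ∑ i ∈ s, c i * (hl (Λ := Λ) k (X i) Z : ℤ) = 0)
    (i₀ : ι) (hi₀ : i₀ ∈ s) (hc₀ : 0 < c i₀) : False := by
  classical
  have hNoeth : IsNoetherianRing Λ := IsNoetherianRing.of_finite k Λ
  have hArt : IsArtinianRing Λ := IsArtinianRing.of_finite k Λ
  let B : Finset ι := s.filter (fun i => c i < 0)
  have hBne : ∀ j ∈ B, c j < 0 := fun j hj => (Finset.mem_filter.1 hj).2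
  have hmemB : ∀ j ∈ s, c j < 0 → j ∈ B := fun j hj h => Finset.mem_filter.2 ⟨hj, h⟩
  -- ExtOk for ranges
  have hEr : ∀ (τ : Type) (d : τ → ι) (Z : Type) [AddCommGroup Z] [Module Λ Z]
      (F : (∀ t, X (d t)) →ₗ[Λ] Z) (l : ι), ExtOk (g l) (LinearMap.range F) := by
    intro τ d Z _ _ F l
    exact extOk_quot (g l) F.rangeRestrict F.surjective_rangeRestrict
      (extOk_pi (g l) _ fun t => hE l (d t))
  -- step 1
  have step1 : ∀ i ∈ s, 0 < c i → ∀ (τ : Type) (_ : Fintype τ) (d : τ → ι)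
      (F : (∀ t, X (d t)) →ₗ[Λ] X i),
      (∀ j ∈ B, ∀ h : X j →ₗ[Λ] X i, ∃ h', F ∘ₗ h' = h) → Surjective F := by
    intro i hi hci τ _ d F hF
    let R := LinearMap.range F
    have hZ : ∀ l, ExtOk (g l) (X i ⧸ R) := fun l =>
      extOk_quot (g l) R.mkQ R.mkQ_surjective (hE l i)
    have hB0 : ∀ j ∈ B, hl (Λ := Λ) k (X j) (X i ⧸ R) = 0 := by
      intro j hj
      apply hl_zero_of
      intro h
      obtain ⟨h', rfl⟩ := extOk_lift (g j) (hg j) R.subtype R.mkQ R.injective_subtype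
        R.mkQ_surjective (by simp) (hEr τ d _ F j) h
      obtain ⟨h'', rfl⟩ := hF j hj h'
      ext x
      simp [R]
    have h1 := hsum (X i ⧸ R) hZ
    rw [Finset.sum_eq_zero_iff_of_nonneg] at h1
    · have h2 := h1 i hi
      have h3 : hl (Λ := Λ) k (X i) (X i ⧸ R) = 0 := by
        rcases mul_eq_zero.1 h2 with h | h
        · omega
        · exact_mod_cast h
      have h4 := hl_eq_zero k h3 R.mkQ
      rw [← LinearMap.range_eq_top]
      change R = ⊤
      rw [← Submodule.ker_mkQ R, h4, LinearMap.ker_zero]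
    · intro j hj
      by_cases hcj : c j < 0
      · simp [hB0 j (hmemB j hj hcj)]
      · exact mul_nonneg (by omega) (by positivity)
  -- generation
  have gen : ∀ l ∈ s, c l ≠ 0 → ∀ (Z : Type) [AddCommGroup Z] [Module Λ Z] (U : Submodule Λ Z),
      (∀ j ∈ B, ∀ h : X j →ₗ[Λ] Z, ∀ x, h x ∈ U) → ∀ h : X l →ₗ[Λ] Z, ∀ x, h x ∈ U := by
    intro l hl hcl Z _ _ U hU h x
    rcases lt_or_gt_of_ne hcl with hneg | hpos
    · exact hU l (hmemB l hl hneg) h x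
    · obtain ⟨τ, _, d, F, hd, hF⟩ := exists_univ (Λ := Λ) k X B (X l)
      obtain ⟨y, rfl⟩ := step1 l hl hpos τ inferInstance d F hF x
      rw [← Finset.univ_sum_single y, map_sum, map_sum]
      refine Submodule.sum_mem _ fun t _ => ?_
      exact hU (d t) (hd t) (h ∘ₗ F ∘ₗ LinearMap.single Λ (fun t => X (d t)) t) (y t)
  obtain ⟨τ, _, d, F, hd, hF⟩ := exists_univ (Λ := Λ) k X B (X i₀)
  obtain ⟨τ', _, d', F', hd', hF'⟩ := exists_univ (Λ := Λ) k X B (LinearMap.ker F)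
  have hU := hsum (LinearMap.range F') (fun l => hEr τ' d' _ F' l)
  have hX := hsum (X i₀) (fun l => hE l i₀)
  have hN := hsum (∀ t, X (d t)) (fun l => extOk_pi (g l) _ fun t => hE l (d t))
  have hUK : ∀ l ∈ s, c l ≠ 0 → hl (Λ := Λ) k (X l) (LinearMap.range F')
      = hl (Λ := Λ) k (X l) (LinearMap.ker F) := by
    intro l hls hcl
    refine hl_of_factor k (X l) (LinearMap.range F').subtype (Submodule.injective_subtype _) ?_
    intro h
    refine ⟨h.codRestrict _ (gen l hls hcl _ _ ?_ h), by ext; rfl⟩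
    intro j hj h x
    obtain ⟨h', rfl⟩ := hF' j hj h
    exact ⟨h' x, rfl⟩
  have hle := fun l => hl_exact_le k (X l) (LinearMap.ker F).subtype F
    (Submodule.injective_subtype _) (by simp)
  have hδ : ∑ l ∈ s, c l * ((hl (Λ := Λ) k (X l) (LinearMap.range F') : ℤ)
      + hl (Λ := Λ) k (X l) (X i₀) - hl (Λ := Λ) k (X l) (∀ t, X (d t))) = 0 := by
    simp only [mul_sub, mul_add, Finset.sum_sub_distrib, Finset.sum_add_distrib, hU, hX, hN]
    simp
  rw [Finset.sum_eq_zero_iff_of_nonneg] at hδ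
  · have h2 := hδ i₀ hi₀
    rw [hUK i₀ hi₀ hc₀.ne'] at h2
    have h3 : hl (Λ := Λ) k (X i₀) (LinearMap.ker F) + hl (Λ := Λ) k (X i₀) (X i₀)
        ≤ hl (Λ := Λ) k (X i₀) (∀ t, X (d t)) := by
      rcases mul_eq_zero.1 h2 with h | h <;> omega
    obtain ⟨σ, hσ⟩ := (hle i₀).2 h3 LinearMap.id
    have hloc := isLocal_end (hXind i₀)
    have hs : IsUnit (∑ t, ((F ∘ₗ LinearMap.single Λ (fun t => X (d t)) t) ∘ₗ (LinearMap.proj t ∘ₗ σ) :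
        Module.End Λ (X i₀))) := by
      have : (∑ t, ((F ∘ₗ LinearMap.single Λ (fun t => X (d t)) t) ∘ₗ (LinearMap.proj t ∘ₗ σ) :
        Module.End Λ (X i₀))) = 1 := by
        ext x
        simp only [LinearMap.sum_apply, LinearMap.comp_apply, LinearMap.proj_apply,
          LinearMap.coe_single]
        rw [← map_sum, Finset.univ_sum_single]
        exact LinearMap.congr_fun hσ x
      rw [this]; exact isUnit_one
    obtain ⟨t, _, ht⟩ := IsLocalRing.exists_of_isUnit_sum hs
    obtain ⟨e⟩ := equiv_of_retract (hXind i₀) (hXind (d t)) _ _ ht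
    have hne : i₀ ≠ d t := by
      intro h
      have := hBne _ (hd t)
      rw [← h] at this
      omega
    exact (hXne _ _ hne).false e
  · intro l hls
    rcases lt_trichotomy (c l) 0 with h | h | h
    · rw [hUK l hls h.ne, hl_exact k (X l) (LinearMap.ker F).subtype F
        (Submodule.injective_subtype _) (by simp) (hF l (hmemB l hls h))]
      simp
    · simp [h]
    · rw [hUK l hls h.ne']
      have := (hle l).1
      exact mul_nonneg h.le (by omega)

end Family

section Additive
variable (k) [IsArtinianRing k] [Module.Finite k Λ]
variable {ι : Type} {P Q : ι → Type} [∀ i, AddCommGroup (P i)] [∀ i, Module Λ (P i)]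
  [∀ i, Module.Finite Λ (P i)] [∀ i, Module.Projective Λ (P i)]
  [∀ i, AddCommGroup (Q i)] [∀ i, Module Λ (Q i)]
  [∀ i, Module.Finite Λ (Q i)] [∀ i, Module.Projective Λ (Q i)]

variable (P Q) in
lemma additive (s : Finset ι) (c : ι → ℤ)
    (hsimple : ∀ (Z : Type) [AddCommGroup Z] [Module Λ Z] [Module k Z] [IsScalarTower k Λ Z]
      [IsSimpleModule Λ Z],
      ∑ i ∈ s, c i * ((hl (Λ := Λ) k (P i) Z : ℤ) - hl (Λ := Λ) k (Q i) Z) = 0)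
    (Z : Type) [AddCommGroup Z] [Module Λ Z] (hZ : IsFiniteLength Λ Z) :
    ∀ [Module k Z] [IsScalarTower k Λ Z],
      ∑ i ∈ s, c i * ((hl (Λ := Λ) k (P i) Z : ℤ) - hl (Λ := Λ) k (Q i) Z) = 0 := by
  have hNoeth : IsNoetherianRing Λ := IsNoetherianRing.of_finite k Λ
  induction hZ with
  | of_subsingleton =>
    intro _ _
    refine Finset.sum_eq_zero fun i _ => ?_
    rw [hl_zero_of, hl_zero_of]
    · simp
    · intro f; ext x; exact Subsingleton.elim _ _
    · intro f; ext x; exact Subsingleton.elim _ _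
  | @of_simple_quotient M _ _ N hsimp hN ih =>
    intro _ _
    have h1 := @ih inferInstance inferInstance
    have h2 := hsimple (M ⧸ N)
    have hM : IsFiniteLength Λ M := .of_simple_quotient hN
    have := (isFiniteLength_iff_isNoetherian_isArtinian.1 hM).1
    have hex : ∀ (R : Type) [AddCommGroup R] [Module Λ R] [Module.Finite Λ R]
        [Module.Projective Λ R],
        hl (Λ := Λ) k R M = hl (Λ := Λ) k R N + hl (Λ := Λ) k R (M ⧸ N) := by
      intro R _ _ _ _
      exact hl_exact k R N.subtype N.mkQ N.injective_subtype (by simp)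
        (fun h => Module.projective_lifting_property _ h N.mkQ_surjective)
    have h3 := congrArg₂ (· + ·) h1 h2
    simp only [← Finset.sum_add_distrib, add_zero] at h3
    rw [← h3]
    refine Finset.sum_congr rfl fun i _ => ?_
    rw [hex (P i), hex (Q i)]
    push_cast
    ring

end Additive

end Stmt8Aux
theorem stmt8 (Λ : Type) [Ring Λ] (k : Type) [CommRing k] [IsArtinianRing k] [Algebra k Λ]
    [Module.Finite k Λ]
    (n : ℕ) (S : Fin n → ModuleCat.{0} Λ)
    (hS : ∀ i, IsSimpleModule Λ (S i))
    (hSne : ∀ i j, i ≠ j → IsEmpty ((S i : Type) ≃ₗ[Λ] (S j : Type)))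
    (hSall : ∀ M : ModuleCat.{0} Λ, IsSimpleModule Λ M →
      ∃ i, Nonempty ((M : Type) ≃ₗ[Λ] (S i : Type)))
    (ι : Type) (X : ι → ModuleCat.{0} Λ)
    (hXfg : ∀ i, Module.Finite Λ (X i))
    (hXind : ∀ i, Indecomposable Λ (X i))
    (hXne : ∀ i j, i ≠ j → IsEmpty ((X i : Type) ≃ₗ[Λ] (X j : Type)))
    (hXpd : ∀ i, pdLE Λ 1 (X i) ∧ ¬ Module.Projective Λ (X i))
    (hXext : ∀ i j, Ext1Vanish Λ (X i) (X j)) :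
    Finite ι ∧ Nat.card ι ≤ n := by
  classical
  have hNoeth : IsNoetherianRing Λ := IsNoetherianRing.of_finite k Λ
  have hArt : IsArtinianRing Λ := IsArtinianRing.of_finite k Λ
  choose P g hPproj hPfin hg hK using fun i => (hXpd i).1
  have hK' : ∀ i, Module.Projective Λ (LinearMap.ker (g i)) := hK
  let mX : ∀ i, Module k (X i) := fun i => Module.compHom (X i) (algebraMap k Λ)
  let mS : ∀ i, Module k (S i) := fun i => Module.compHom (S i) (algebraMap k Λ)
  have tX : ∀ i, IsScalarTower k Λ (X i) := fun i => ⟨fun a b x => by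
    rw [Algebra.smul_def, mul_smul]; rfl⟩
  have tS : ∀ i, IsScalarTower k Λ (S i) := fun i => ⟨fun a b x => by
    rw [Algebra.smul_def, mul_smul]; rfl⟩
  have hE : ∀ i j, Stmt8Aux.ExtOk (g i) (X j) := fun i j =>
    Stmt8Aux.extOk_of_vanish (g i) (hg i) (X j) (hXext i j)
  let v : ι → Fin n → ℤ := fun i j => (Stmt8Aux.hl (Λ := Λ) k (P i) (S j) : ℤ)
    - Stmt8Aux.hl (Λ := Λ) k (LinearMap.ker (g i)) (S j)
  -- no positive coefficient in a relation
  have main : ∀ (s : Finset ι) (c : ι → ℤ), ∑ i ∈ s, c i • v i = 0 →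
      ∀ i ∈ s, ¬ 0 < c i := by
    intro s c hrel i hi hci
    refine Stmt8Aux.key_false k (fun i => (X i : Type)) g hg hXind hXne hE s c ?_ i hi hci
    intro Z _ _ _ _ _ hZ
    have hfl : IsFiniteLength Λ Z :=
      isFiniteLength_iff_isNoetherian_isArtinian.2 ⟨inferInstance, inferInstance⟩
    have hadd := Stmt8Aux.additive k (fun i => (P i : Type))
      (fun i => (LinearMap.ker (g i) : Type)) s c ?_ Z hfl
    · rw [← hadd]
      refine Finset.sum_congr rfl fun l _ => ?_
      have := Stmt8Aux.hl_pres k (A := Z) (g l) (hg l) (hZ l)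
      rw [this]
      push_cast
      ring
    · intro Y _ _ _ _ hY
      obtain ⟨j, ⟨e⟩⟩ := hSall (ModuleCat.of Λ Y) hY
      have hj := congrFun hrel j
      simp only [Finset.sum_apply, Pi.smul_apply, smul_eq_mul, Pi.zero_apply, v] at hj
      have := (hS j)
      rw [← hj]
      refine Finset.sum_congr rfl fun l _ => ?_
      have e' : Y ≃ₗ[Λ] (S j : Type) := e
      rw [Stmt8Aux.hl_congr k (P l) e', Stmt8Aux.hl_congr k (LinearMap.ker (g l)) e']
  have hli : LinearIndependent ℤ v := by
    rw [linearIndependent_iff']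
    intro s c hrel i hi
    have h1 := main s c hrel i hi
    have h2 := main s (fun i => - c i) (by
      simp only [neg_smul, Finset.sum_neg_distrib, hrel, neg_zero]) i hi
    omega
  have hfin : Finite ι := hli.finite
  refine ⟨hfin, ?_⟩
  have := Fintype.ofFinite ι
  rw [Nat.card_eq_fintype_card]
  simpa using hli.fintype_card_le_finrank
end

section
/- Let Λ be an artin algebra. Then C_Λ contains a module that is simultaneously tilting and cotilting if and only if Λ is 1-Auslander-Gorenstein, i.e., id(ΛΛ) ≤ 2 ≤ domdim Λ. -/
open Function LinearMap

section Aux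

variable {Λ : Type} [Ring Λ]

/-- `M` is a retract (direct summand) of `N`. -/
def Ret (Λ : Type) [Ring Λ] (M N : Type) [AddCommGroup M] [Module Λ M] [AddCommGroup N]
    [Module Λ N] : Prop :=
  ∃ (s : M →ₗ[Λ] N) (p : N →ₗ[Λ] M), p ∘ₗ s = LinearMap.id

variable {M N X Y Z W : Type} [AddCommGroup M] [Module Λ M] [AddCommGroup N] [Module Λ N]
  [AddCommGroup X] [Module Λ X] [AddCommGroup Y] [Module Λ Y] [AddCommGroup Z] [Module Λ Z]
  [AddCommGroup W] [Module Λ W]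

lemma inj_ext (hZ : Module.Injective Λ Z) (f : X →ₗ[Λ] Y) (hf : Injective f) (g : X →ₗ[Λ] Z) :
    ∃ h : Y →ₗ[Λ] Z, h ∘ₗ f = g := by
  obtain ⟨h, hh⟩ := hZ.out f hf g
  exact ⟨h, LinearMap.ext hh⟩

lemma lift_inj (j : X →ₗ[Λ] Y) (hj : Injective j) (h : Z →ₗ[Λ] Y)
    (H : ∀ z, h z ∈ LinearMap.range j) : ∃ l : Z →ₗ[Λ] X, j ∘ₗ l = h := by
  refine ⟨(LinearEquiv.ofInjective j hj).symm.toLinearMap ∘ₗ h.codRestrict _ H, ?_⟩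
  ext z
  have := LinearEquiv.apply_symm_apply (LinearEquiv.ofInjective j hj) (h.codRestrict _ H z)
  exact congrArg Subtype.val this

lemma proj_lift (hZ : Module.Projective Λ Z) (g : X →ₗ[Λ] Y) (h : Z →ₗ[Λ] Y)
    (H : ∀ z, h z ∈ LinearMap.range g) : ∃ l : Z →ₗ[Λ] X, g ∘ₗ l = h := by
  obtain ⟨l, hl⟩ := Module.projective_lifting_property g.rangeRestrict (h.codRestrict _ H)
    g.surjective_rangeRestrict
  refine ⟨l, ?_⟩
  ext z
  exact congrArg Subtype.val (LinearMap.congr_fun hl z)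

lemma desc_surj (c : X →ₗ[Λ] Y) (hc : Surjective c) (h : X →ₗ[Λ] Z)
    (H : ∀ x, c x = 0 → h x = 0) : ∃ l : Y →ₗ[Λ] Z, l ∘ₗ c = h := by
  have hk : LinearMap.ker c ≤ LinearMap.ker h := fun x hx => H x hx
  refine ⟨(LinearMap.ker c).liftQ h hk ∘ₗ (c.quotKerEquivOfSurjective hc).symm.toLinearMap, ?_⟩
  ext x
  have : (c.quotKerEquivOfSurjective hc).symm (c x) = (LinearMap.ker c).mkQ x := by
    rw [LinearEquiv.symm_apply_eq]; rfl
  simp [this]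

lemma Ret.refl : Ret Λ M M := ⟨LinearMap.id, LinearMap.id, rfl⟩

lemma Ret.of_equiv (e : M ≃ₗ[Λ] N) : Ret Λ M N :=
  ⟨e.toLinearMap, e.symm.toLinearMap, by ext; simp⟩

lemma Ret.trans (h : Ret Λ M N) (h' : Ret Λ N X) : Ret Λ M X := by
  obtain ⟨s, p, h⟩ := h
  obtain ⟨s', p', h'⟩ := h'
  refine ⟨s' ∘ₗ s, p ∘ₗ p', ?_⟩
  ext x
  have h1 := LinearMap.congr_fun h' (s x)
  have h2 := LinearMap.congr_fun h x
  simp at h1 h2 ⊢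
  rw [h1, h2]

lemma Ret.prod (h : Ret Λ M N) (h' : Ret Λ X Y) : Ret Λ (M × X) (N × Y) := by
  obtain ⟨s, p, h⟩ := h
  obtain ⟨s', p', h'⟩ := h'
  refine ⟨s.prodMap s', p.prodMap p', ?_⟩
  rw [LinearMap.prodMap_comp, h, h', LinearMap.prodMap_id]

lemma Ret.pi (n : ℕ) (h : Ret Λ M N) : Ret Λ (Fin n → M) (Fin n → N) := by
  obtain ⟨s, p, h⟩ := h
  refine ⟨s.compLeft _, p.compLeft _, ?_⟩
  refine LinearMap.ext fun v => funext fun i => ?_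
  exact LinearMap.congr_fun h (v i)

lemma Ret.fst : Ret Λ M (M × N) := ⟨LinearMap.inl _ _ _, LinearMap.fst _ _ _, by ext; simp⟩
lemma Ret.snd : Ret Λ N (M × N) := ⟨LinearMap.inr _ _ _, LinearMap.snd _ _ _, by ext; simp⟩

lemma Ret.projective (h : Ret Λ M N) (hN : Module.Projective Λ N) : Module.Projective Λ M := by
  obtain ⟨s, p, h⟩ := h
  exact Module.Projective.of_split s p h

lemma Ret.injective (h : Ret Λ M N) (hN : Module.Injective Λ N) : Module.Injective Λ M := by
  obtain ⟨s, p, h⟩ := h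
  refine ⟨fun X Y _ _ _ _ f hf g => ?_⟩
  obtain ⟨l, hl⟩ := hN.out f hf (s ∘ₗ g)
  refine ⟨p ∘ₗ l, fun x => ?_⟩
  have := LinearMap.congr_fun h (g x)
  simp at this
  simp [hl, this]

lemma Ret.finite (h : Ret Λ M N) (hN : Module.Finite Λ N) : Module.Finite Λ M := by
  obtain ⟨s, p, h⟩ := h
  exact Module.Finite.of_surjective p (fun x => ⟨s x, LinearMap.congr_fun h x⟩)

lemma Ret.of_inj (hM : Module.Injective Λ M) (f : M →ₗ[Λ] N) (hf : Injective f) : Ret Λ M N := by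
  obtain ⟨p, hp⟩ := inj_ext hM f hf LinearMap.id
  exact ⟨f, p, hp⟩

lemma Ret.of_surj (hM : Module.Projective Λ M) (g : N →ₗ[Λ] M) (hg : Surjective g) :
    Ret Λ M N := by
  obtain ⟨p, hp⟩ := Module.projective_lifting_property g LinearMap.id hg
  exact ⟨p, g, hp⟩

lemma inj_prod (hM : Module.Injective Λ M) (hN : Module.Injective Λ N) :
    Module.Injective Λ (M × N) := by
  refine ⟨fun X Y _ _ _ _ f hf g => ?_⟩
  obtain ⟨l, hl⟩ := hM.out f hf (LinearMap.fst _ _ _ ∘ₗ g)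
  obtain ⟨l', hl'⟩ := hN.out f hf (LinearMap.snd _ _ _ ∘ₗ g)
  exact ⟨l.prod l', fun x => Prod.ext (hl x) (hl' x)⟩

lemma inj_pi (n : ℕ) (hM : Module.Injective Λ M) : Module.Injective Λ (Fin n → M) := by
  refine ⟨fun X Y _ _ _ _ f hf g => ?_⟩
  have := fun i => hM.out f hf (LinearMap.proj i ∘ₗ g)
  choose l hl using this
  exact ⟨LinearMap.pi l, fun x => funext fun i => hl i x⟩

lemma pinj_prod (hM : IsProjInj Λ M) (hN : IsProjInj Λ N) : IsProjInj Λ (M × N) := by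
  have := hM.1
  have := hN.1
  exact ⟨inferInstance, inj_prod hM.2 hN.2⟩

lemma pinj_pi (n : ℕ) (hM : IsProjInj Λ M) : IsProjInj Λ (Fin n → M) := by
  have := hM.1
  exact ⟨Module.Projective.of_equiv' (DFinsupp.linearEquivFunOnFintype (R := Λ) (M := fun _ : Fin n => M)),
    inj_pi n hM.2⟩

lemma Ret.pinj (h : Ret Λ M N) (hN : IsProjInj Λ N) : IsProjInj Λ M :=
  ⟨h.projective hN.1, h.injective hN.2⟩

lemma fg_proj_ret (hM : Module.Projective Λ M) (hf : Module.Finite Λ M) :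
    ∃ n : ℕ, Ret Λ M (Fin n → Λ) := by
  obtain ⟨n, f, hf⟩ := Module.Finite.exists_fin' Λ M
  exact ⟨n, Ret.of_surj hM f hf⟩

lemma inAdd_iff {T : Type} [AddCommGroup T] [Module Λ T] :
    InAddOf Λ T M ↔ ∃ m : ℕ, Ret Λ M (Fin m → T) :=
  ⟨fun ⟨m, p, s, h⟩ => ⟨m, s, p, h⟩, fun ⟨m, s, p, h⟩ => ⟨m, p, s, h⟩⟩

section InAdd
variable {T : Type} [AddCommGroup T] [Module Λ T]

lemma inAdd_ret (h : Ret Λ M N) (hN : InAddOf Λ T N) : InAddOf Λ T M := by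
  rw [inAdd_iff] at *
  obtain ⟨m, hm⟩ := hN
  exact ⟨m, h.trans hm⟩

lemma inAdd_self : InAddOf Λ T T :=
  inAdd_iff.2 ⟨1, Ret.of_equiv (LinearEquiv.funUnique (Fin 1) Λ T).symm⟩

lemma inAdd_prod (hM : InAddOf Λ T M) (hN : InAddOf Λ T N) : InAddOf Λ T (M × N) := by
  rw [inAdd_iff] at *
  obtain ⟨m, hm⟩ := hM
  obtain ⟨n, hn⟩ := hN
  refine ⟨m + n, (hm.prod hn).trans (Ret.of_equiv ?_)⟩
  exact (LinearEquiv.sumArrowLequivProdArrow (Fin m) (Fin n) Λ T).symm.trans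
    (LinearEquiv.funCongrLeft Λ T finSumFinEquiv.symm)

lemma inAdd_pi (k : ℕ) (hM : InAddOf Λ T M) : InAddOf Λ T (Fin k → M) := by
  rw [inAdd_iff] at *
  obtain ⟨m, hm⟩ := hM
  refine ⟨k * m, (hm.pi k).trans (Ret.of_equiv ?_)⟩
  exact (LinearEquiv.curry Λ T (Fin k) (Fin m)).symm.trans
    (LinearEquiv.funCongrLeft Λ T finProdFinEquiv.symm)

lemma inAdd_zero [Subsingleton M] : InAddOf Λ T M :=
  ⟨0, 0, 0, LinearMap.ext fun _ => Subsingleton.elim _ _⟩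

end InAdd

/-- cokernels of a retract -/
lemma coker_ret {P D C Q : Type} [AddCommGroup P] [Module Λ P] [AddCommGroup D] [Module Λ D]
    [AddCommGroup C] [Module Λ C] [AddCommGroup Q] [Module Λ Q]
    (hQ : Module.Injective Λ Q) (s : P →ₗ[Λ] M) (p : M →ₗ[Λ] P) (hps : p ∘ₗ s = LinearMap.id)
    (f : M →ₗ[Λ] Q) (hf : Injective f) (c : Q →ₗ[Λ] C) (hc : Surjective c)
    (hfc : LinearMap.range f = LinearMap.ker c)
    (c' : Q →ₗ[Λ] D) (hc' : Surjective c') (hfc' : LinearMap.range (f ∘ₗ s) = LinearMap.ker c') :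
    Ret Λ D (C × Q) := by
  obtain ⟨β, hβ⟩ := inj_ext hQ f hf (f ∘ₗ s ∘ₗ p)
  have hβ' : ∀ m, β (f m) = f (s (p m)) := fun m => LinearMap.congr_fun hβ m
  have hz : ∀ x, c' (f (s x)) = 0 := fun x => by
    have : f (s x) ∈ LinearMap.ker c' := hfc' ▸ ⟨x, rfl⟩
    exact this
  have hz' : ∀ x, c (f x) = 0 := fun x => by
    have : f x ∈ LinearMap.ker c := hfc ▸ ⟨x, rfl⟩
    exact this
  have hk : ∀ q, c q = 0 → ∃ m, f m = q := fun q hq => by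
    have : q ∈ LinearMap.range f := hfc ▸ hq
    exact this
  have hk' : ∀ q, c' q = 0 → ∃ m, f (s m) = q := fun q hq => by
    have : q ∈ LinearMap.range (f ∘ₗ s) := hfc' ▸ hq
    exact this
  have hpsx : ∀ x, p (s x) = x := fun x => LinearMap.congr_fun hps x
  obtain ⟨a, ha⟩ := desc_surj c' hc' c (fun x hx => by
    obtain ⟨m, rfl⟩ := hk' x hx; exact hz' _)
  obtain ⟨b, hb⟩ := desc_surj c hc (c' ∘ₗ β) (fun x hx => by
    obtain ⟨m, rfl⟩ := hk x hx; simp [hβ', hz])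
  obtain ⟨g, hg⟩ := desc_surj c' hc' (LinearMap.id - β) (fun x hx => by
    obtain ⟨m, rfl⟩ := hk' x hx; simp [hβ', hpsx])
  refine ⟨a.prod g, b.coprod c', ?_⟩
  refine LinearMap.ext fun d => ?_
  obtain ⟨q, rfl⟩ := hc' d
  have h1 := LinearMap.congr_fun ha q
  have h2 := LinearMap.congr_fun hb q
  have h3 := LinearMap.congr_fun hg q
  simp at h1 h2 h3
  simp [h1, h2, h3]

/-- kernels of a retract -/
lemma ker_ret {J L K I Q : Type} [AddCommGroup J] [Module Λ J] [AddCommGroup L] [Module Λ L]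
    [AddCommGroup K] [Module Λ K] [AddCommGroup Q] [Module Λ Q] [AddCommGroup I] [Module Λ I]
    (hQ : Module.Projective Λ Q) (s : J →ₗ[Λ] I) (p : I →ₗ[Λ] J) (hps : p ∘ₗ s = LinearMap.id)
    (π : Q →ₗ[Λ] I) (hπ : Surjective π) (j : K →ₗ[Λ] Q) (hj : Injective j)
    (hjπ : LinearMap.range j = LinearMap.ker π)
    (j' : L →ₗ[Λ] Q) (hj' : Injective j') (hjπ' : LinearMap.range j' = LinearMap.ker (p ∘ₗ π)) :
    Ret Λ L (K × Q) := by
  obtain ⟨β, hβ⟩ := Module.projective_lifting_property π (s ∘ₗ p ∘ₗ π) hπ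
  have hβ' : ∀ m, π (β m) = s (p (π m)) := fun m => LinearMap.congr_fun hβ m
  have hpsx : ∀ x, p (s x) = x := fun x => LinearMap.congr_fun hps x
  have hz : ∀ x, π (j x) = 0 := fun x => by
    have : j x ∈ LinearMap.ker π := hjπ ▸ ⟨x, rfl⟩
    exact this
  have hz' : ∀ x, p (π (j' x)) = 0 := fun x => by
    have : j' x ∈ LinearMap.ker (p ∘ₗ π) := hjπ' ▸ ⟨x, rfl⟩
    exact this
  obtain ⟨a, ha⟩ := lift_inj j hj (β ∘ₗ j') (fun x => by rw [hjπ]; simp [hβ', hz'])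
  obtain ⟨b, hb⟩ := lift_inj j' hj' j (fun x => by rw [hjπ']; simp [hz])
  obtain ⟨g, hg⟩ := lift_inj j' hj' (LinearMap.id - β) (fun x => by
    rw [hjπ']; simp [hβ', hpsx])
  refine ⟨a.prod j', b.coprod g, ?_⟩
  refine LinearMap.ext fun x => ?_
  apply hj'
  have h1 := LinearMap.congr_fun ha x
  have h2 := LinearMap.congr_fun hb (a x)
  have h3 := LinearMap.congr_fun hg (j' x)
  simp at h1 h2 h3
  simp [h1, h2, h3]

end Aux


section Dim

open CategoryTheory

variable {Λ : Type} [Ring Λ]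

lemma ses_mk {X Y Z : Type} [AddCommGroup X] [Module Λ X] [AddCommGroup Y]
    [Module Λ Y] [AddCommGroup Z] [Module Λ Z]
    (f : X →ₗ[Λ] Y) (g : Y →ₗ[Λ] Z) (hf : Function.Injective f) (hg : Surjective g)
    (h : LinearMap.range f = LinearMap.ker g) :
    ∃ hfg : g.comp f = 0, (ShortComplex.moduleCatMk f g hfg).ShortExact := by
  have hex : Function.Exact f g := LinearMap.exact_iff.2 h.symm
  exact ⟨hex.linearMap_comp_eq_zero, ModuleCat.shortComplex_shortExact _ hex hf hg⟩

lemma injObj (X : ModuleCat.{0} Λ) (h : Module.Injective Λ X) : CategoryTheory.Injective X :=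
  (Module.injective_iff_injective_object Λ X).1 h

lemma idLEcat_iff (n : ℕ) : ∀ X : ModuleCat.{0} Λ,
    idLEcat Λ n X ↔ HasInjectiveDimensionLT X (n + 1) := by
  induction n with
  | zero =>
    intro X
    rw [← injective_iff_hasInjectiveDimensionLT_one]
    exact Module.injective_iff_injective_object Λ X
  | succ n ih =>
    intro X
    constructor
    · rintro ⟨I, f, hI, hf, h⟩
      rw [ih] at h
      obtain ⟨hz, hs⟩ := ses_mk f (LinearMap.range f).mkQ hf (Submodule.mkQ_surjective _) (by simp)
      exact (hs.hasInjectiveDimensionLT_X₃_iff n (injObj I hI)).1 h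
    · intro h
      let I := CategoryTheory.Injective.under X
      let f := CategoryTheory.Injective.ι X
      have hf : Function.Injective f.hom := (ModuleCat.mono_iff_injective f).1 inferInstance
      have hI : Module.Injective Λ I := (Module.injective_iff_injective_object Λ I).2
        (CategoryTheory.Injective.injective_under X)
      refine ⟨I, f.hom, hI, hf, ?_⟩
      rw [ih]
      obtain ⟨hz, hs⟩ := ses_mk f.hom (LinearMap.range f.hom).mkQ hf
        (Submodule.mkQ_surjective _) (by simp)
      exact (hs.hasInjectiveDimensionLT_X₃_iff n (injObj I hI)).2 h

section
variable {X Y Z : Type} [AddCommGroup X] [Module Λ X] [AddCommGroup Y]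
    [Module Λ Y] [AddCommGroup Z] [Module Λ Z]

lemma idLE_coker {n : ℕ} (f : X →ₗ[Λ] Y) (g : Y →ₗ[Λ] Z) (hf : Function.Injective f)
    (hg : Surjective g) (h : LinearMap.range f = LinearMap.ker g) (hY : Module.Injective Λ Y) :
    idLE Λ n Z ↔ idLE Λ (n + 1) X := by
  obtain ⟨hz, hs⟩ := ses_mk f g hf hg h
  unfold idLE
  rw [idLEcat_iff, idLEcat_iff]
  exact hs.hasInjectiveDimensionLT_X₃_iff n (injObj (ModuleCat.of Λ Y) hY)

lemma idLE_two (f : X →ₗ[Λ] Y) (g : Y →ₗ[Λ] Z) (hf : Function.Injective f)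
    (hg : Surjective g) (h : LinearMap.range f = LinearMap.ker g) (hY : idLE Λ 1 Y)
    (hZ : idLE Λ 1 Z) : idLE Λ 2 X := by
  obtain ⟨hz, hs⟩ := ses_mk f g hf hg h
  unfold idLE at *
  rw [idLEcat_iff] at *
  have hY' : HasInjectiveDimensionLT (ShortComplex.moduleCatMk f g hz).X₂ 2 := hY
  exact hs.hasInjectiveDimensionLT_X₁ 2 hZ (hasInjectiveDimensionLT_of_ge _ 2 3 (by omega))

end

lemma idLE_one_add {T M : Type} [AddCommGroup T] [Module Λ T] [AddCommGroup M] [Module Λ M]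
    (hT : idLE Λ 1 T) (hM : InAddOf Λ T M) : idLE Λ 1 M := by
  obtain ⟨I, f, hI, hf, h⟩ := hT
  change Module.Injective Λ (I ⧸ LinearMap.range f) at h
  obtain ⟨m, s, p, hps⟩ := inAdd_iff.1 hM
  have hfm : Function.Injective (f.compLeft (Fin m)) := fun v w hvw =>
    funext fun i => hf (congrFun hvw i)
  have hinj : Function.Injective (f.compLeft (Fin m) ∘ₗ s) := by
    refine hfm.comp ?_
    exact LeftInverse.injective (g := p) (fun x => LinearMap.congr_fun hps x)
  refine ⟨ModuleCat.of Λ (Fin m → I), f.compLeft (Fin m) ∘ₗ s, inj_pi m hI, hinj, ?_⟩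
  refine Ret.injective ?_ (inj_prod (inj_pi m h) (inj_pi m hI))
  refine coker_ret (inj_pi m hI) s p hps (f.compLeft (Fin m)) hfm
    ((LinearMap.range f).mkQ.compLeft (Fin m)) ?_ ?_
    (LinearMap.range (f.compLeft (Fin m) ∘ₗ s)).mkQ (Submodule.mkQ_surjective _) (by simp)
  · intro v
    choose w hw using fun i => Submodule.mkQ_surjective _ (v i)
    exact ⟨w, funext hw⟩
  · ext v
    constructor
    · rintro ⟨w, rfl⟩
      refine LinearMap.mem_ker.2 (funext fun i => ?_)
      simp
    · intro hv
      have : ∀ i, ∃ x, f x = v i := fun i => by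
        have := congrFun (LinearMap.mem_ker.1 hv) i
        simpa using this
      choose w hw using this
      exact ⟨w, funext hw⟩

end Dim

section Forward

variable {Λ : Type} [Ring Λ]

lemma gen_add {T M : Type} [AddCommGroup T] [Module Λ T] [AddCommGroup M] [Module Λ M]
    (hT : GenByProjInj Λ T) (hM : InAddOf Λ T M) : GenByProjInj Λ M := by
  obtain ⟨Q, hQ, hQ', f, hf⟩ := hT
  obtain ⟨m, s, p, hps⟩ := inAdd_iff.1 hM
  refine ⟨ModuleCat.of Λ (Fin m → Q), inferInstanceAs (Module.Finite Λ (Fin m → Q)),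
    pinj_pi m hQ', p ∘ₗ f.compLeft (Fin m), ?_⟩
  intro x
  choose w hw using fun i => hf (s x i)
  refine ⟨w, ?_⟩
  have : f.compLeft (Fin m) w = s x := funext hw
  rw [LinearMap.comp_apply, this]
  exact LinearMap.congr_fun hps x

lemma cogen_add {T M : Type} [AddCommGroup T] [Module Λ T] [AddCommGroup M] [Module Λ M]
    (hT : CogenByProjInj Λ T) (hM : InAddOf Λ T M) : CogenByProjInj Λ M := by
  obtain ⟨Q, hQ, hQ', f, hf⟩ := hT
  obtain ⟨m, s, p, hps⟩ := inAdd_iff.1 hM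
  refine ⟨ModuleCat.of Λ (Fin m → Q), inferInstanceAs (Module.Finite Λ (Fin m → Q)),
    pinj_pi m hQ', f.compLeft (Fin m) ∘ₗ s, ?_⟩
  have hfm : Function.Injective (f.compLeft (Fin m)) := fun v w hvw =>
    funext fun i => hf (congrFun hvw i)
  refine hfm.comp ?_
  exact LeftInverse.injective (g := p) (fun x => LinearMap.congr_fun hps x)

lemma domdim_of {T0 T1 : Type} [AddCommGroup T0] [Module Λ T0] [AddCommGroup T1] [Module Λ T1]
    (f : Λ →ₗ[Λ] T0) (g : T0 →ₗ[Λ] T1) (hf : Injective f) (hg : Surjective g)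
    (hfg : LinearMap.range f = LinearMap.ker g) (h0 : GenByProjInj Λ T0)
    (h1 : GenByProjInj Λ T1) (h1' : CogenByProjInj Λ T1) : DomdimGE2 Λ := by
  obtain ⟨A, hA, hA', ρ, hρ⟩ := h0
  obtain ⟨B, hB, hB', π, hπ⟩ := h1
  obtain ⟨I1, hI, hI', j, hj⟩ := h1'
  have := hA'.1
  have := hB'.1
  have hk : ∀ q, g q = 0 → q ∈ LinearMap.range f := fun q hq => hfg ▸ hq
  have hz : ∀ x, g (f x) = 0 := fun x => by
    have : f x ∈ LinearMap.ker g := hfg ▸ ⟨x, rfl⟩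
    exact this
  obtain ⟨a, ha⟩ := Module.projective_lifting_property g π hg
  obtain ⟨b, hb⟩ := Module.projective_lifting_property π (g ∘ₗ ρ) hπ
  have ha' : ∀ x, g (a x) = π x := fun x => LinearMap.congr_fun ha x
  have hb' : ∀ x, π (b x) = g (ρ x) := fun x => LinearMap.congr_fun hb x
  obtain ⟨c, hc⟩ := lift_inj f hf (ρ - a ∘ₗ b) (fun x => hk _ (by simp [ha', hb']))
  obtain ⟨d, hd⟩ := lift_inj f hf (a ∘ₗ (LinearMap.ker π).subtype)
    (fun x => hk _ (by simp [ha']))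
  have hc' : ∀ x, f (c x) = ρ x - a (b x) := fun x => LinearMap.congr_fun hc x
  have hd' : ∀ x, f (d x) = a x := fun x => LinearMap.congr_fun hd x
  have hsurj : Surjective (d.coprod c) := by
    intro l
    obtain ⟨q, hq⟩ := hρ (f l)
    have : π (b q) = 0 := by rw [hb', hq, hz]
    refine ⟨(⟨b q, this⟩, q), hf ?_⟩
    simp [hc', hd', hq]
  obtain ⟨s, hs⟩ := Module.projective_lifting_property (d.coprod c) LinearMap.id hsurj
  have hs' : ∀ x, (d.coprod c) (s x) = x := fun x => LinearMap.congr_fun hs x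
  let ι : (LinearMap.ker π × A) →ₗ[Λ] (B × A) :=
    (LinearMap.ker π).subtype.prodMap LinearMap.id
  have hι : Injective ι := by
    rintro ⟨x, y⟩ ⟨x', y'⟩ h
    simp [ι] at h
    exact Prod.ext h.1 h.2
  have hinj : IsProjInj Λ (B × A) := pinj_prod hB' hA'
  obtain ⟨R, hR⟩ := inj_ext hinj.2 ι hι (ι ∘ₗ (LinearMap.id - s ∘ₗ d.coprod c))
  have hR' : ∀ x, R (ι x) = ι (x - s (d.coprod c x)) := fun x => LinearMap.congr_fun hR x
  refine ⟨ModuleCat.of Λ (B × A), ModuleCat.of Λ ((B × A) × I1), ι ∘ₗ s,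
    R.prod (j ∘ₗ π ∘ₗ LinearMap.fst _ _ _), inferInstanceAs (Module.Finite Λ (B × A)), hinj,
    inferInstanceAs (Module.Finite Λ ((B × A) × I1)), pinj_prod hinj hI', ?_, ?_⟩
  · exact hι.comp (LeftInverse.injective (g := d.coprod c) hs')
  · ext x
    constructor
    · rintro ⟨l, rfl⟩
      refine LinearMap.mem_ker.2 (Prod.ext ?_ ?_)
      · change R (ι (s l)) = 0
        rw [hR', hs', sub_self, map_zero]
      · change j (π ((s l).1 : B)) = 0
        rw [LinearMap.mem_ker.1 (s l).1.2, map_zero]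
    · intro hx
      have h1 : R x = 0 := congrArg Prod.fst (LinearMap.mem_ker.1 hx)
      have h2 : j (π x.1) = 0 := congrArg Prod.snd (LinearMap.mem_ker.1 hx)
      have h3 : π x.1 = 0 := hj (by rw [h2, map_zero])
      have hx' : ι (⟨x.1, h3⟩, x.2) = x := rfl
      rw [← hx', hR'] at h1
      have := hι (h1.trans (map_zero ι).symm)
      refine ⟨d.coprod c (⟨x.1, h3⟩, x.2), ?_⟩
      rw [sub_eq_zero] at this
      rw [LinearMap.comp_apply, ← this]
      exact hx'

lemma forward_dir (T : ModuleCat.{0} Λ) (ht : IsTilting Λ T) (hc : IsCotilting Λ T)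
    (hm : MemC Λ T) : idLE Λ 2 Λ ∧ DomdimGE2 Λ := by
  obtain ⟨-, -, T0, T1, f, g, h0, h1, hf, hg, hfg⟩ := ht
  exact ⟨idLE_two f g hf hg hfg (idLE_one_add hc.1 h0) (idLE_one_add hc.1 h1),
    domdim_of f g hf hg hfg (gen_add hm.1 h0) (gen_add hm.1 h1) (cogen_add hm.2 h1)⟩

end Forward


section Indec

variable {Λ : Type} [Ring Λ]

/-- nonzero module with every endomorphism nilpotent or bijective -/
def IsLoc (Λ : Type) [Ring Λ] (M : Type) [AddCommGroup M] [Module Λ M] : Prop :=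
  Nontrivial M ∧ ∀ e : Module.End Λ M, IsNilpotent e ∨ Bijective e

variable {M N X Y Z W S : Type} [AddCommGroup M] [Module Λ M] [AddCommGroup N] [Module Λ N]
  [AddCommGroup X] [Module Λ X] [AddCommGroup Y] [Module Λ Y] [AddCommGroup Z] [Module Λ Z]
  [AddCommGroup W] [Module Λ W] [AddCommGroup S] [Module Λ S]

lemma Ret.of_isCompl_left {A B : Submodule Λ M} (h : IsCompl A B) : Ret Λ A M :=
  Ret.fst.trans (Ret.of_equiv (Submodule.prodEquivOfIsCompl A B h))

lemma exists_loc [IsArtinianRing Λ] (Φ : ModuleCat.{0} Λ → Prop)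
    (hnt : ∀ M, Φ M → Nontrivial M)
    (hsp : ∀ (M : ModuleCat.{0} Λ) (A B : Submodule Λ M), IsCompl A B → Φ M →
      Φ (ModuleCat.of Λ A) ∨ Φ (ModuleCat.of Λ B)) (n : ℕ) :
    ∀ (M : ModuleCat.{0} Λ), Module.Finite Λ M → Module.length Λ M = n → Φ M →
    ∃ J : ModuleCat.{0} Λ, Φ J ∧ IsLoc Λ J ∧ Ret Λ J M := by
  induction n using Nat.strong_induction_on with
  | _ n ih =>
  intro M hM hn hΦ
  by_cases hl : IsLoc Λ M
  · exact ⟨M, hΦ, hl, Ret.refl⟩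
  have hne := hnt M hΦ
  simp only [IsLoc, hne, true_and, not_forall, not_or] at hl
  obtain ⟨e, he1, he2⟩ := hl
  have hA : IsArtinian Λ M := isArtinian_of_fg_of_artinian' 
  have hN : IsNoetherian Λ M := inferInstance
  obtain ⟨m, hm⟩ := Filter.eventually_atTop.1 (LinearMap.eventually_isCompl_ker_pow_range_pow e)
  have hc := hm (m + 1) (Nat.le_succ m)
  have h1 : LinearMap.ker (e ^ (m + 1)) ≠ ⊤ := fun h => he1 ⟨m + 1, LinearMap.ker_eq_top.1 h⟩
  have h2 : LinearMap.range (e ^ (m + 1)) ≠ ⊤ := fun h => he2 (by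
    have hs : Surjective e := by
      have : Surjective (e ^ (m + 1)) := LinearMap.range_eq_top.1 h
      rw [pow_succ'] at this
      exact Surjective.of_comp this
    exact IsNoetherian.bijective_of_surjective_endomorphism e hs)
  have key : ∀ A B : Submodule Λ M, IsCompl A B → A ≠ ⊤ → Φ (ModuleCat.of Λ A) →
      ∃ J : ModuleCat.{0} Λ, Φ J ∧ IsLoc Λ J ∧ Ret Λ J M := by
    intro A B hAB hA hΦA
    have hlt := Submodule.length_lt hA
    rw [hn] at hlt
    obtain ⟨a, ha⟩ := ENat.ne_top_iff_exists.1 (ne_top_of_lt hlt)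
    rw [← ha] at hlt
    obtain ⟨J, h1, h2, h3⟩ := ih a (by exact_mod_cast hlt) (ModuleCat.of Λ A)
      (inferInstanceAs (Module.Finite Λ A)) ha.symm hΦA
    exact ⟨J, h1, h2, h3.trans (Ret.of_isCompl_left hAB)⟩
  rcases hsp M _ _ hc hΦ with h | h
  · exact key _ _ hc h1 h
  · exact key _ _ hc.symm h2 h

lemma exists_loc' [IsArtinianRing Λ] (Φ : ModuleCat.{0} Λ → Prop)
    (hnt : ∀ M, Φ M → Nontrivial M)
    (hsp : ∀ (M : ModuleCat.{0} Λ) (A B : Submodule Λ M), IsCompl A B → Φ M →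
      Φ (ModuleCat.of Λ A) ∨ Φ (ModuleCat.of Λ B))
    (M : ModuleCat.{0} Λ) (hM : Module.Finite Λ M) (h : Φ M) :
    ∃ J : ModuleCat.{0} Λ, Φ J ∧ IsLoc Λ J ∧ Ret Λ J M := by
  have hA : IsArtinian Λ M := isArtinian_of_fg_of_artinian'
  have hN : IsNoetherian Λ M := inferInstance
  obtain ⟨a, ha⟩ := ENat.ne_top_iff_exists.1 (Module.length_ne_top (R := Λ) (M := M))
  exact exists_loc Φ hnt hsp a M hM ha.symm h

lemma not_nilp_of_fix (e : Module.End Λ M) (i : S →ₗ[Λ] M) (hi : i ≠ 0) (h : e ∘ₗ i = i) :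
    ¬ IsNilpotent e := by
  rintro ⟨n, hn⟩
  apply hi
  have : ∀ k : ℕ, (e ^ k) ∘ₗ i = i := by
    intro k
    induction k with
    | zero => rfl
    | succ k ih =>
      rw [pow_succ, Module.End.mul_eq_comp, LinearMap.comp_assoc, h, ih]
  rw [← this n, hn, LinearMap.zero_comp]

lemma equiv_of_bij {a : M →ₗ[Λ] N} {b : N →ₗ[Λ] M} (h1 : Bijective (b ∘ₗ a))
    (h2 : Bijective (a ∘ₗ b)) : Nonempty (M ≃ₗ[Λ] N) :=
  ⟨LinearEquiv.ofBijective a ⟨Injective.of_comp h1.1, Surjective.of_comp h2.2⟩⟩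

lemma inj_unique (hM : IsLoc Λ M) (hN : IsLoc Λ N) (iM : Module.Injective Λ M)
    (iN : Module.Injective Λ N) [Nontrivial S] (f : S →ₗ[Λ] M) (g : S →ₗ[Λ] N)
    (hf : Injective f) (hg : Injective g) : Nonempty (M ≃ₗ[Λ] N) := by
  have nz : ∀ {A : Type} [AddCommGroup A] [Module Λ A] (f : S →ₗ[Λ] A), Injective f → f ≠ 0 := by
    intro A _ _ f hf h0
    obtain ⟨x, hx⟩ := exists_ne (0 : S)
    exact hx (hf (by simp [h0]))
  obtain ⟨a, ha⟩ := inj_ext iN f hf g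
  obtain ⟨b, hb⟩ := inj_ext iM g hg f
  refine equiv_of_bij (a := a) (b := b) ?_ ?_
  · refine (hM.2 (b ∘ₗ a)).resolve_left (not_nilp_of_fix _ f (nz f hf) ?_)
    rw [LinearMap.comp_assoc, ha, hb]
  · refine (hN.2 (a ∘ₗ b)).resolve_left (not_nilp_of_fix _ g (nz g hg) ?_)
    rw [LinearMap.comp_assoc, hb, ha]

lemma proj_top (hM : IsLoc Λ M) (pM : Module.Projective Λ M) [IsSimpleModule Λ X]
    [IsSimpleModule Λ Y] (f : M →ₗ[Λ] X) (g : M →ₗ[Λ] Y) (hf : Surjective f)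
    (hg : Surjective g) : Nonempty (X ≃ₗ[Λ] Y) := by
  by_cases hk : LinearMap.ker f = LinearMap.ker g
  · exact ⟨(f.quotKerEquivOfSurjective hf).symm.trans
      ((Submodule.quotEquivOfEq _ _ hk).trans (g.quotKerEquivOfSurjective hg))⟩
  exfalso
  have cf : IsCoatom (LinearMap.ker f) := by
    rw [← isSimpleModule_iff_isCoatom]
    exact IsSimpleModule.congr (f.quotKerEquivOfSurjective hf)
  have cg : IsCoatom (LinearMap.ker g) := by
    rw [← isSimpleModule_iff_isCoatom]
    exact IsSimpleModule.congr (g.quotKerEquivOfSurjective hg)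
  have hsup : LinearMap.ker f ⊔ LinearMap.ker g = ⊤ := cf.sup_eq_top_of_ne cg hk
  have hs : Surjective ((LinearMap.ker f).subtype.coprod (LinearMap.ker g).subtype) := by
    rw [← LinearMap.range_eq_top, LinearMap.range_coprod]
    simpa using hsup
  obtain ⟨σ, hσ⟩ := Module.projective_lifting_property _ LinearMap.id hs
  let a : Module.End Λ M := (LinearMap.ker f).subtype ∘ₗ LinearMap.fst _ _ _ ∘ₗ σ
  let b : Module.End Λ M := (LinearMap.ker g).subtype ∘ₗ LinearMap.snd _ _ _ ∘ₗ σ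
  have hab : a + b = 1 := by
    ext x
    exact LinearMap.congr_fun hσ x
  have ntX : Nontrivial X := IsSimpleModule.nontrivial Λ X
  have ntY : Nontrivial Y := IsSimpleModule.nontrivial Λ Y
  have na : ¬ Bijective a := by
    intro h
    obtain ⟨x, hx⟩ := exists_ne (0 : X)
    obtain ⟨m, rfl⟩ := hf x
    obtain ⟨m', rfl⟩ := h.2 m
    exact hx (σ m').1.2
  have nb : ¬ Bijective b := by
    intro h
    obtain ⟨x, hx⟩ := exists_ne (0 : Y)
    obtain ⟨m, rfl⟩ := hg x
    obtain ⟨m', rfl⟩ := h.2 m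
    exact hx (σ m').2.2
  have ha := (hM.2 a).resolve_right na
  have hb : b = 1 - a := by rw [← hab]; abel
  apply nb
  have : IsUnit b := by rw [hb]; exact ha.isUnit_one_sub
  exact (Module.End.isUnit_iff b).1 this

lemma pow_comm' {a : Module.End Λ M} {b : Module.End Λ N} {f : M →ₗ[Λ] N}
    (h : f ∘ₗ a = b ∘ₗ f) (n : ℕ) : f ∘ₗ (a ^ n : Module.End Λ M) = (b ^ n : Module.End Λ N) ∘ₗ f := by
  induction n with
  | zero => rfl
  | succ n ih =>
    rw [pow_succ, pow_succ, Module.End.mul_eq_comp, Module.End.mul_eq_comp, ← LinearMap.comp_assoc,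
      ih, LinearMap.comp_assoc, h, LinearMap.comp_assoc]

/-- exact sequence `0 → P → Q0 → Q1 → I → 0` with projective-injective middle terms. -/
structure Res4 {P Q0 Q1 I : Type} [AddCommGroup P] [Module Λ P] [AddCommGroup Q0] [Module Λ Q0]
    [AddCommGroup Q1] [Module Λ Q1] [AddCommGroup I] [Module Λ I]
    (i : P →ₗ[Λ] Q0) (d : Q0 →ₗ[Λ] Q1) (π : Q1 →ₗ[Λ] I) : Prop where
  pi0 : IsProjInj Λ Q0
  pi1 : IsProjInj Λ Q1
  inj : Injective i
  ex0 : LinearMap.range i = LinearMap.ker d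
  ex1 : LinearMap.range d = LinearMap.ker π
  surj : Surjective π

section
variable {P Q0 Q1 I : Type} [AddCommGroup P] [Module Λ P] [AddCommGroup Q0] [Module Λ Q0]
    [AddCommGroup Q1] [Module Λ Q1] [AddCommGroup I] [Module Λ I]
    {i : P →ₗ[Λ] Q0} {d : Q0 →ₗ[Λ] Q1} {π : Q1 →ₗ[Λ] I}
    {P' Q0' Q1' I' : Type} [AddCommGroup P'] [Module Λ P'] [AddCommGroup Q0'] [Module Λ Q0']
    [AddCommGroup Q1'] [Module Λ Q1'] [AddCommGroup I'] [Module Λ I']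
    {i' : P' →ₗ[Λ] Q0'} {d' : Q0' →ₗ[Λ] Q1'} {π' : Q1' →ₗ[Λ] I'}

lemma Res4.di (h : Res4 i d π) (x : P) : d (i x) = 0 := by
  have : i x ∈ LinearMap.ker d := h.ex0 ▸ ⟨x, rfl⟩
  exact this

lemma Res4.πd (h : Res4 i d π) (x : Q0) : π (d x) = 0 := by
  have : d x ∈ LinearMap.ker π := h.ex1 ▸ ⟨x, rfl⟩
  exact this

lemma Res4.lift (h : Res4 i d π) (h' : Res4 i' d' π') (u : I →ₗ[Λ] I') :
    ∃ (α : P →ₗ[Λ] P') (β0 : Q0 →ₗ[Λ] Q0') (β1 : Q1 →ₗ[Λ] Q1'),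
      i' ∘ₗ α = β0 ∘ₗ i ∧ d' ∘ₗ β0 = β1 ∘ₗ d ∧ π' ∘ₗ β1 = u ∘ₗ π := by
  have := h.pi1.1
  obtain ⟨β1, h1⟩ := Module.projective_lifting_property π' (u ∘ₗ π) h'.surj
  obtain ⟨β0, h0⟩ := proj_lift h.pi0.1 d' (β1 ∘ₗ d) (fun z => by
    rw [h'.ex1, LinearMap.mem_ker]
    have := LinearMap.congr_fun h1 (d z)
    simp only [LinearMap.comp_apply] at this ⊢
    rw [this, h.πd, map_zero])
  obtain ⟨α, hα⟩ := lift_inj i' h'.inj (β0 ∘ₗ i) (fun z => by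
    rw [h'.ex0, LinearMap.mem_ker]
    have := LinearMap.congr_fun h0 (i z)
    simp only [LinearMap.comp_apply] at this ⊢
    rw [this, h.di, map_zero])
  exact ⟨α, β0, β1, hα, h0, h1⟩

lemma Res4.null (h : Res4 i d π) {β0 : Module.End Λ Q0} {β1 : Module.End Λ Q1}
    {e : Module.End Λ I} (h0 : β0 ∘ₗ i = 0) (h1 : d ∘ₗ β0 = β1 ∘ₗ d) (h2 : π ∘ₗ β1 = e ∘ₗ π) :
    ∃ t : I →ₗ[Λ] Q1, π ∘ₗ t = e := by
  -- `β0` extends along `d`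
  obtain ⟨l, hl⟩ := desc_surj d.rangeRestrict d.surjective_rangeRestrict β0 (fun x hx => by
    have hx' : d x = 0 := congrArg Subtype.val hx
    have : x ∈ LinearMap.range i := h.ex0 ▸ hx'
    obtain ⟨y, rfl⟩ := this
    exact LinearMap.congr_fun h0 y)
  obtain ⟨k, hk⟩ := inj_ext h.pi0.2 (LinearMap.range d).subtype (Submodule.injective_subtype _) l
  have hkd : ∀ x, k (d x) = β0 x := fun x => by
    have e1 := LinearMap.congr_fun hk (d.rangeRestrict x)
    have e2 := LinearMap.congr_fun hl x
    exact e1.trans e2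
  obtain ⟨t, ht⟩ := desc_surj π h.surj (β1 - d ∘ₗ k) (fun x hx => by
    have : x ∈ LinearMap.range d := h.ex1 ▸ hx
    obtain ⟨y, rfl⟩ := this
    have := LinearMap.congr_fun h1 y
    simp only [LinearMap.comp_apply] at this
    simp [hkd, this])
  refine ⟨t, ?_⟩
  refine LinearMap.ext fun z => ?_
  obtain ⟨q, rfl⟩ := h.surj z
  have e1 := LinearMap.congr_fun ht q
  have e2 := LinearMap.congr_fun h2 q
  simp only [LinearMap.comp_apply, LinearMap.sub_apply] at e1 e2 ⊢
  rw [e1, map_sub, h.πd, sub_zero, e2]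

lemma Res4.bij (h : Res4 i d π) (hP : IsLoc Λ P) {J : Type} [AddCommGroup J] [Module Λ J]
    (hJ : ¬ Module.Projective Λ J) (s : J →ₗ[Λ] I) (p : I →ₗ[Λ] J) (hps : p ∘ₗ s = LinearMap.id)
    {α : Module.End Λ P} {β0 : Module.End Λ Q0} {β1 : Module.End Λ Q1}
    (h0 : i ∘ₗ α = β0 ∘ₗ i) (h1 : d ∘ₗ β0 = β1 ∘ₗ d) (h2 : π ∘ₗ β1 = (s ∘ₗ p) ∘ₗ π) :
    Bijective α := by
  refine (hP.2 α).resolve_left ?_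
  rintro ⟨n, hn⟩
  apply hJ
  have e0 := pow_comm' (b := β0) h0 n
  have e1 := pow_comm' (b := β1) h1 n
  have e2 := pow_comm' (b := (s ∘ₗ p : Module.End Λ I)) h2 n
  rw [hn, LinearMap.comp_zero] at e0
  obtain ⟨t, ht⟩ := h.null e0.symm e1 e2
  have hfix : ∀ k : ℕ, ((s ∘ₗ p : Module.End Λ I) ^ k) ∘ₗ s = s := by
    intro k
    induction k with
    | zero => rfl
    | succ k ih =>
      rw [pow_succ, Module.End.mul_eq_comp, LinearMap.comp_assoc, LinearMap.comp_assoc, hps,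
        LinearMap.comp_id, ih]
  refine Ret.projective ⟨t ∘ₗ s, p ∘ₗ π, ?_⟩ h.pi1.1
  calc (p ∘ₗ π) ∘ₗ t ∘ₗ s = p ∘ₗ ((π ∘ₗ t) ∘ₗ s) := rfl
    _ = LinearMap.id := by rw [ht, hfix, hps]

lemma Res4.unique (h : Res4 i d π) (h' : Res4 i' d' π') (hP : IsLoc Λ P) (hP' : IsLoc Λ P')
    {J : Type} [AddCommGroup J] [Module Λ J] (hJ : ¬ Module.Projective Λ J)
    (hr : Ret Λ J I) (hr' : Ret Λ J I') : Nonempty (P ≃ₗ[Λ] P') := by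
  obtain ⟨s, p, hps⟩ := hr
  obtain ⟨s', p', hps'⟩ := hr'
  obtain ⟨α, β0, β1, a0, a1, a2⟩ := h.lift h' (s' ∘ₗ p)
  obtain ⟨α', β0', β1', b0, b1, b2⟩ := h'.lift h (s ∘ₗ p')
  refine equiv_of_bij (a := α) (b := α') ?_ ?_
  · refine h.bij hP hJ s p hps (α := α' ∘ₗ α) (β0 := β0' ∘ₗ β0) (β1 := β1' ∘ₗ β1) ?_ ?_ ?_
    · rw [← LinearMap.comp_assoc, b0, LinearMap.comp_assoc, a0]; rfl
    · rw [← LinearMap.comp_assoc, b1, LinearMap.comp_assoc, a1]; rfl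
    · rw [← LinearMap.comp_assoc, b2, LinearMap.comp_assoc, a2]
      calc (s ∘ₗ p') ∘ₗ (s' ∘ₗ p) ∘ₗ π = s ∘ₗ (p' ∘ₗ s') ∘ₗ p ∘ₗ π := rfl
        _ = _ := by rw [hps']; rfl
  · refine h'.bij hP' hJ s' p' hps' (α := α ∘ₗ α') (β0 := β0 ∘ₗ β0') (β1 := β1 ∘ₗ β1') ?_ ?_ ?_
    · rw [← LinearMap.comp_assoc, a0, LinearMap.comp_assoc, b0]; rfl
    · rw [← LinearMap.comp_assoc, a1, LinearMap.comp_assoc, b1]; rfl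
    · rw [← LinearMap.comp_assoc, a2, LinearMap.comp_assoc, b2]
      calc (s' ∘ₗ p) ∘ₗ (s ∘ₗ p') ∘ₗ π' = s' ∘ₗ (p ∘ₗ s) ∘ₗ p' ∘ₗ π' := rfl
        _ = _ := by rw [hps]; rfl

end

/-- Finitely many simple quotients. -/
lemma simples_of_finLength (M : Type) [AddCommGroup M] [Module Λ M] (h : IsFiniteLength Λ M) :
    ∃ l : List (ModuleCat.{0} Λ), ∀ S : ModuleCat.{0} Λ, IsSimpleModule Λ S →
      (∃ f : M →ₗ[Λ] S, f ≠ 0) → ∃ S' ∈ l, Nonempty (S ≃ₗ[Λ] S') := by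
  induction h with
  | of_subsingleton =>
    refine ⟨[], fun S _ ⟨f, hf⟩ => (hf ?_).elim⟩
    ext x
    rw [Subsingleton.elim x 0, map_zero, map_zero]
  | @of_simple_quotient M _ _ N hs hN ih =>
    obtain ⟨l, hl⟩ := ih
    refine ⟨ModuleCat.of Λ (M ⧸ N) :: l, fun S hS ⟨f, hf⟩ => ?_⟩
    by_cases h0 : f ∘ₗ N.subtype = 0
    · refine ⟨_, List.mem_cons_self, ?_⟩
      let g : (M ⧸ N) →ₗ[Λ] S := N.liftQ f (fun x hx => LinearMap.congr_fun h0 ⟨x, hx⟩)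
      have hg : g ≠ 0 := fun h => hf (by
        ext x
        exact LinearMap.congr_fun h (N.mkQ x))
      exact ⟨(LinearEquiv.ofBijective g (LinearMap.bijective_of_ne_zero hg)).symm⟩
    · obtain ⟨S', h1, h2⟩ := hl S hS ⟨_, h0⟩
      exact ⟨S', List.mem_cons_of_mem _ h1, h2⟩

end Indec


section Backward

variable {Λ : Type} [Ring Λ]

lemma simple_pigeon [IsArtinianRing Λ] (R : ModuleCat.{0} Λ → ModuleCat.{0} Λ → Prop)
    (h1 : ∀ S : ModuleCat.{0} Λ, IsSimpleModule Λ S →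
      ∃ S' : ModuleCat.{0} Λ, IsSimpleModule Λ S' ∧ R S S')
    (h2 : ∀ S1 S2 S' S'' : ModuleCat.{0} Λ, IsSimpleModule Λ S1 → IsSimpleModule Λ S2 →
      IsSimpleModule Λ S' → IsSimpleModule Λ S'' → R S1 S' → R S2 S'' →
      Nonempty (S' ≃ₗ[Λ] S'') → Nonempty (S1 ≃ₗ[Λ] S2)) (X : ModuleCat.{0} Λ)
    (hX : IsSimpleModule Λ X) :
    ∃ S S' : ModuleCat.{0} Λ, IsSimpleModule Λ S ∧ R S S' ∧ Nonempty (S' ≃ₗ[Λ] X) := by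
  let A := {S : ModuleCat.{0} Λ // IsSimpleModule Λ S}
  let r : Setoid A :=
    { r := fun a b => Nonempty (a.1 ≃ₗ[Λ] b.1)
      iseqv := ⟨fun a => ⟨LinearEquiv.refl _ _⟩, fun ⟨e⟩ => ⟨e.symm⟩, fun ⟨e⟩ ⟨e'⟩ => ⟨e.trans e'⟩⟩ }
  have hfl : IsFiniteLength Λ Λ :=
    isFiniteLength_iff_isNoetherian_isArtinian.2 ⟨inferInstance, inferInstance⟩
  obtain ⟨l, hl⟩ := simples_of_finLength Λ hfl
  have hfin : Finite (Quotient r) := by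
    have : ∀ q : Quotient r, ∃ S' ∈ l, Nonempty (q.out.1 ≃ₗ[Λ] S') := fun q => by
      refine hl q.out.1 q.out.2 ?_
      have := q.out.2
      have hnt := IsSimpleModule.nontrivial Λ q.out.1
      obtain ⟨x, hx⟩ := exists_ne (0 : q.out.1)
      refine ⟨LinearMap.toSpanSingleton Λ _ x, fun h => hx ?_⟩
      have := LinearMap.congr_fun h 1
      simpa using this
    choose φ hφ1 hφ2 using this
    have hfl : Finite {x // x ∈ l} := l.finite_toSet.to_subtype
    refine Finite.of_injective (fun q => (⟨φ q, hφ1 q⟩ : {x // x ∈ l})) ?_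
    intro q q' h
    have h' : φ q = φ q' := congrArg Subtype.val h
    obtain ⟨e⟩ := hφ2 q
    obtain ⟨e'⟩ := hφ2 q'
    rw [← h'] at e'
    rw [← q.out_eq, ← q'.out_eq]
    exact Quotient.sound ⟨e.trans e'.symm⟩
  choose σ hσ1 hσ2 using fun a : A => h1 a.1 a.2
  let τ : Quotient r → Quotient r := fun q => Quotient.mk r ⟨σ q.out, hσ1 q.out⟩
  have hτ : Injective τ := by
    intro q q' h
    have h' := Quotient.exact h
    rw [← q.out_eq, ← q'.out_eq]
    exact Quotient.sound (h2 _ _ _ _ q.out.2 q'.out.2 (hσ1 _) (hσ1 _) (hσ2 _) (hσ2 _) h')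
  obtain ⟨q, hq⟩ := (Finite.injective_iff_surjective.1 hτ) (Quotient.mk r ⟨X, hX⟩)
  exact ⟨q.out.1, σ q.out, q.out.2, hσ2 _, Quotient.exact hq⟩

lemma exists_simple_sub [IsArtinianRing Λ] (M : Type) [AddCommGroup M] [Module Λ M]
    [Module.Finite Λ M] [Nontrivial M] :
    ∃ S : ModuleCat.{0} Λ, IsSimpleModule Λ S ∧ ∃ f : S →ₗ[Λ] M, Injective f := by
  have : IsArtinian Λ M := inferInstance
  have : IsAtomic (Submodule Λ M) := inferInstance
  obtain ⟨A, hA⟩ := IsAtomic.exists_atom (Submodule Λ M)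
  exact ⟨ModuleCat.of Λ A, isSimpleModule_iff_isAtom.2 hA, A.subtype, A.injective_subtype⟩

section comp
variable {X Y Z : Type} [AddCommGroup X] [Module Λ X] [AddCommGroup Y] [Module Λ Y]
  [AddCommGroup Z] [Module Λ Z]

lemma compLeft_inj (n : ℕ) {f : X →ₗ[Λ] Y} (hf : Injective f) : Injective (f.compLeft (Fin n)) :=
  fun _ _ hvw => funext fun i => hf (congrFun hvw i)

lemma compLeft_surj (n : ℕ) {f : X →ₗ[Λ] Y} (hf : Surjective f) :
    Surjective (f.compLeft (Fin n)) := by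
  intro v
  choose w hw using fun i => hf (v i)
  exact ⟨w, funext hw⟩

lemma compLeft_exact (n : ℕ) {f : X →ₗ[Λ] Y} {g : Y →ₗ[Λ] Z}
    (h : LinearMap.range f = LinearMap.ker g) :
    LinearMap.range (f.compLeft (Fin n)) = LinearMap.ker (g.compLeft (Fin n)) := by
  ext v
  constructor
  · rintro ⟨w, rfl⟩
    refine LinearMap.mem_ker.2 (funext fun i => ?_)
    have : f (w i) ∈ LinearMap.ker g := h ▸ ⟨w i, rfl⟩
    exact this
  · intro hv
    have : ∀ i, ∃ x, f x = v i := fun i => by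
      have h1 : v i ∈ LinearMap.ker g := congrFun (LinearMap.mem_ker.1 hv) i
      rw [← h] at h1
      exact h1
    choose w hw using this
    exact ⟨w, funext hw⟩

end comp

/-- The basic data. -/
structure Setup {Q0 Q1 C I0 : Type} [AddCommGroup Q0] [Module Λ Q0]
    [AddCommGroup Q1] [Module Λ Q1] [AddCommGroup C] [Module Λ C] [AddCommGroup I0] [Module Λ I0]
    (f : Λ →ₗ[Λ] Q0) (c : Q0 →ₗ[Λ] C) (j : C →ₗ[Λ] Q1) (π : Q1 →ₗ[Λ] I0)
    (T : Type) [AddCommGroup T] [Module Λ T] : Prop where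
  fin0 : Module.Finite Λ Q0
  fin1 : Module.Finite Λ Q1
  pi0 : IsProjInj Λ Q0
  pi1 : IsProjInj Λ Q1
  injf : Injective f
  ex0 : LinearMap.range f = LinearMap.ker c
  surjc : Surjective c
  injj : Injective j
  ex1 : LinearMap.range j = LinearMap.ker π
  surjπ : Surjective π
  injI : Module.Injective Λ I0
  add0 : InAddOf Λ T Q0
  addC : InAddOf Λ T C

section setup
variable {Q0 Q1 C I0 : Type} [AddCommGroup Q0] [Module Λ Q0]
    [AddCommGroup Q1] [Module Λ Q1] [AddCommGroup C] [Module Λ C] [AddCommGroup I0] [Module Λ I0]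
    {f : Λ →ₗ[Λ] Q0} {c : Q0 →ₗ[Λ] C} {j : C →ₗ[Λ] Q1} {π : Q1 →ₗ[Λ] I0}
    {T : Type} [AddCommGroup T] [Module Λ T]

lemma Setup.pinj_add (h : Setup f c j π T) {X : Type} [AddCommGroup X] [Module Λ X]
    (hX : Module.Finite Λ X) (hX' : IsProjInj Λ X) : InAddOf Λ T X := by
  obtain ⟨n, s, p, hps⟩ := fg_proj_ret hX'.1 hX
  refine inAdd_ret (Ret.of_inj hX'.2 (f.compLeft (Fin n) ∘ₗ s) ?_) (inAdd_pi n h.add0)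
  exact (compLeft_inj n h.injf).comp
    (LeftInverse.injective (g := p) (fun x => LinearMap.congr_fun hps x))

/-- The right-hand (nontrivial) part of the link between projectives and injectives. -/
def ResAdd (T P I : Type) [AddCommGroup T] [Module Λ T] [AddCommGroup P] [Module Λ P]
    [AddCommGroup I] [Module Λ I] : Prop :=
  ∃ (A B : ModuleCat.{0} Λ) (i : P →ₗ[Λ] A) (d : A →ₗ[Λ] B) (ρ : B →ₗ[Λ] I),
    Res4 i d ρ ∧ Module.Finite Λ B ∧ InAddOf Λ T (LinearMap.ker ρ)

lemma Setup.exists_res (h : Setup f c j π T) {P : Type} [AddCommGroup P] [Module Λ P]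
    (hP : Module.Finite Λ P) (hP' : Module.Projective Λ P) :
    ∃ I : ModuleCat.{0} Λ, Module.Injective Λ I ∧ Module.Finite Λ I ∧ ResAdd (Λ := Λ) T P I := by
  obtain ⟨n, s, p, hps⟩ := fg_proj_ret hP' hP
  have := h.fin0
  have := h.fin1
  have hs : Injective s := LeftInverse.injective (g := p) (fun x => LinearMap.congr_fun hps x)
  have hi : Injective (f.compLeft (Fin n) ∘ₗ s) := (compLeft_inj n h.injf).comp hs
  let i := f.compLeft (Fin n) ∘ₗ s
  let q := (LinearMap.range i).mkQ
  have hq : Surjective q := Submodule.mkQ_surjective _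
  have hD : Ret Λ ((Fin n → Q0) ⧸ LinearMap.range i) ((Fin n → C) × (Fin n → Q0)) :=
    coker_ret (inj_pi n h.pi0.2) s p hps (f.compLeft (Fin n)) (compLeft_inj n h.injf)
      (c.compLeft (Fin n)) (compLeft_surj n h.surjc) (compLeft_exact n h.ex0) q hq (by simp [q, i])
  have hDadd : InAddOf Λ T ((Fin n → Q0) ⧸ LinearMap.range i) :=
    inAdd_ret hD (inAdd_prod (inAdd_pi n h.addC) (inAdd_pi n h.add0))
  obtain ⟨σ, τ, hστ⟩ := hD
  have hσ : Injective σ := LeftInverse.injective (g := τ) (fun x => LinearMap.congr_fun hστ x)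
  let E : ((Fin n → C) × (Fin n → Q0)) →ₗ[Λ] ((Fin n → Q1) × (Fin n → Q0)) :=
    (j.compLeft (Fin n)).prodMap LinearMap.id
  have hE : Injective E := by
    rintro ⟨x, y⟩ ⟨x', y'⟩ hxy
    have h1 : j.compLeft (Fin n) x = j.compLeft (Fin n) x' := congrArg Prod.fst hxy
    have h2 : y = y' := congrArg Prod.snd hxy
    exact Prod.ext (compLeft_inj n h.injj h1) h2
  let πN : ((Fin n → Q1) × (Fin n → Q0)) →ₗ[Λ] (Fin n → I0) :=
    π.compLeft (Fin n) ∘ₗ LinearMap.fst _ _ _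
  have hEπ : LinearMap.range E = LinearMap.ker πN := by
    ext ⟨x, y⟩
    have hx : x ∈ LinearMap.range (j.compLeft (Fin n)) ↔ π.compLeft (Fin n) x = 0 := by
      rw [compLeft_exact n h.ex1, LinearMap.mem_ker]
    constructor
    · rintro ⟨⟨a, b⟩, hab⟩
      exact hx.1 ⟨a, congrArg Prod.fst hab⟩
    · intro hxy
      obtain ⟨a, ha⟩ := hx.2 hxy
      exact ⟨(a, y), Prod.ext ha rfl⟩
  have hpi : IsProjInj Λ ((Fin n → Q1) × (Fin n → Q0)) :=
    pinj_prod (pinj_pi n h.pi1) (pinj_pi n h.pi0)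
  let i1 := E ∘ₗ σ
  have hi1 : Injective i1 := hE.comp hσ
  let ρ := (LinearMap.range i1).mkQ
  have hI : Ret Λ (((Fin n → Q1) × (Fin n → Q0)) ⧸ LinearMap.range i1)
      ((Fin n → I0) × ((Fin n → Q1) × (Fin n → Q0))) :=
    coker_ret hpi.2 σ τ hστ E hE πN
      ((compLeft_surj n h.surjπ).comp Prod.fst_surjective) hEπ ρ (Submodule.mkQ_surjective _)
      (by simp [ρ, i1])
  refine ⟨ModuleCat.of Λ (((Fin n → Q1) × (Fin n → Q0)) ⧸ LinearMap.range i1),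
    hI.injective (inj_prod (inj_pi n h.injI) hpi.2),
    inferInstanceAs (Module.Finite Λ (((Fin n → Q1) × (Fin n → Q0)) ⧸ LinearMap.range i1)),
    ModuleCat.of Λ (Fin n → Q0), ModuleCat.of Λ ((Fin n → Q1) × (Fin n → Q0)),
    i, i1 ∘ₗ q, ρ, ?_, inferInstanceAs (Module.Finite Λ ((Fin n → Q1) × (Fin n → Q0))), ?_⟩
  · refine ⟨pinj_pi n h.pi0, hpi, hi, ?_, ?_, Submodule.mkQ_surjective _⟩
    · change LinearMap.range i = LinearMap.ker (i1 ∘ₗ q)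
      rw [LinearMap.ker_comp_of_ker_eq_bot _ (LinearMap.ker_eq_bot.2 hi1)]
      simp [q]
    · change LinearMap.range (i1 ∘ₗ q) = LinearMap.ker ρ
      rw [LinearMap.range_comp_of_range_eq_top _ (LinearMap.range_eq_top.2 hq)]
      simp [ρ]
  · refine inAdd_ret (Ret.of_equiv ?_) hDadd
    have : LinearMap.ker ρ = LinearMap.range i1 := by simp [ρ]
    exact (LinearEquiv.ofEq _ _ this).trans (LinearEquiv.ofInjective i1 hi1).symm

/-- The link between a simple top and a simple socle. -/
def RelS (T : Type) [AddCommGroup T] [Module Λ T] (S S' : ModuleCat.{0} Λ) : Prop :=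
  ∃ P J : ModuleCat.{0} Λ, IsLoc Λ P ∧ Module.Projective Λ P ∧ IsLoc Λ J ∧ Module.Finite Λ J ∧
    Module.Injective Λ J ∧ (∃ g : P →ₗ[Λ] S, Surjective g) ∧ (∃ f : S' →ₗ[Λ] J, Injective f) ∧
    (Nonempty (P ≃ₗ[Λ] J) ∨ (¬ Module.Projective Λ J ∧ ∃ I : ModuleCat.{0} Λ,
      ResAdd (Λ := Λ) T P I ∧ Ret Λ J I))

lemma proj_of_split_top {M : Type} [AddCommGroup M] [Module Λ M] {A B : Submodule Λ M}
    (h : IsCompl A B) (hA : Module.Projective Λ A) (hB : Module.Projective Λ B) :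
    Module.Projective Λ M :=
  Module.Projective.of_equiv' (Submodule.prodEquivOfIsCompl A B h)

lemma Setup.rel_exists [IsArtinianRing Λ] (h : Setup f c j π T) (S : ModuleCat.{0} Λ)
    (hS : IsSimpleModule Λ S) : ∃ S' : ModuleCat.{0} Λ, IsSimpleModule Λ S' ∧ RelS T S S' := by
  have hnt := IsSimpleModule.nontrivial Λ S
  obtain ⟨P, ⟨⟨hPp, hPf⟩, g, hg⟩, hPl, -⟩ := exists_loc' (Λ := Λ)
    (fun M => (Module.Projective Λ M ∧ Module.Finite Λ M) ∧ ∃ g : M →ₗ[Λ] S, g ≠ 0)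
    (by
      rintro M ⟨-, g, hg⟩
      by_contra hn
      rw [not_nontrivial_iff_subsingleton] at hn
      exact hg (LinearMap.ext fun x => by rw [Subsingleton.elim x 0, map_zero, map_zero]))
    (by
      rintro M A B hAB ⟨⟨hp, hf⟩, g, hg⟩
      have rA : Ret Λ A M := Ret.of_isCompl_left hAB
      have rB : Ret Λ B M := Ret.of_isCompl_left hAB.symm
      by_cases hA : g ∘ₗ A.subtype = 0
      · right
        refine ⟨⟨rB.projective hp, rB.finite hf⟩, g ∘ₗ B.subtype, fun hB => hg ?_⟩
        rw [← LinearMap.ker_eq_top, eq_top_iff, ← hAB.sup_eq_top, sup_le_iff]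
        exact ⟨fun x hx => LinearMap.congr_fun hA ⟨x, hx⟩,
          fun x hx => LinearMap.congr_fun hB ⟨x, hx⟩⟩
      · left
        exact ⟨⟨rA.projective hp, rA.finite hf⟩, g ∘ₗ A.subtype, hA⟩)
    (ModuleCat.of Λ Λ) (inferInstanceAs (Module.Finite Λ Λ)) (by
      refine ⟨⟨inferInstanceAs (Module.Projective Λ Λ), inferInstanceAs (Module.Finite Λ Λ)⟩, ?_⟩
      obtain ⟨x, hx⟩ := exists_ne (0 : S)
      refine ⟨LinearMap.toSpanSingleton Λ S x, fun h => hx ?_⟩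
      have := LinearMap.congr_fun h (1 : Λ)
      simpa using this)
  have hgs : Surjective g := LinearMap.surjective_of_ne_zero hg
  by_cases hPi : Module.Injective Λ P
  · have := hPl.1
    obtain ⟨S', hS', k, hk⟩ := exists_simple_sub (Λ := Λ) P
    exact ⟨S', hS', P, P, hPl, hPp, hPl, hPf, hPi, ⟨g, hgs⟩, ⟨k, hk⟩,
      Or.inl ⟨LinearEquiv.refl _ _⟩⟩
  · obtain ⟨I, hIi, hIf, hres⟩ := h.exists_res hPf hPp
    have hIp : ¬ Module.Projective Λ I := by
      intro hIp
      apply hPi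
      obtain ⟨A, B, i, d, ρ, hr, -, -⟩ := hres
      -- `ker ρ` is a summand of `B`, hence projective, hence `P` is a summand of `A`
      obtain ⟨t, ht⟩ := Module.projective_lifting_property ρ LinearMap.id hr.surj
      have ht' : ∀ x, ρ (t x) = x := fun x => LinearMap.congr_fun ht x
      obtain ⟨u, hu⟩ := proj_lift hr.pi1.1 d (LinearMap.id - t ∘ₗ ρ) (fun z => by
        rw [hr.ex1]; simp [ht'])
      have hu' : ∀ x, d (u x) = x - t (ρ x) := fun x => LinearMap.congr_fun hu x
      obtain ⟨v, hv⟩ := lift_inj i hr.inj (LinearMap.id - u ∘ₗ d) (fun z => by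
        rw [hr.ex0]; simp [hu', hr.πd])
      refine Ret.injective ⟨i, v, ?_⟩ hr.pi0.2
      refine LinearMap.ext fun x => hr.inj ?_
      have := LinearMap.congr_fun hv (i x)
      simp only [LinearMap.comp_apply] at this ⊢
      rw [this]
      simp [hr.di]
    obtain ⟨J, ⟨⟨hJi, hJf⟩, hJp⟩, hJl, hJr⟩ := exists_loc' (Λ := Λ)
      (fun M => (Module.Injective Λ M ∧ Module.Finite Λ M) ∧ ¬ Module.Projective Λ M)
      (by
        rintro M ⟨-, hn⟩
        by_contra hs
        rw [not_nontrivial_iff_subsingleton] at hs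
        exact hn (Module.Projective.of_split (0 : M →ₗ[Λ] Λ) 0
          (LinearMap.ext fun _ => Subsingleton.elim _ _)))
      (by
        rintro M A B hAB ⟨⟨hi, hf⟩, hn⟩
        have rA : Ret Λ A M := Ret.of_isCompl_left hAB
        have rB : Ret Λ B M := Ret.of_isCompl_left hAB.symm
        by_cases hA : Module.Projective Λ A
        · right
          exact ⟨⟨rB.injective hi, rB.finite hf⟩, fun hB => hn (proj_of_split_top hAB hA hB)⟩
        · left
          exact ⟨⟨rA.injective hi, rA.finite hf⟩, hA⟩)
      I hIf ⟨⟨hIi, hIf⟩, hIp⟩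
    have := hJl.1
    obtain ⟨S', hS', k, hk⟩ := exists_simple_sub (Λ := Λ) J
    exact ⟨S', hS', P, J, hPl, hPp, hJl, hJf, hJi, ⟨g, hgs⟩, ⟨k, hk⟩,
      Or.inr ⟨hJp, I, hres, hJr⟩⟩

lemma rel_unique (S1 S2 S' S'' : ModuleCat.{0} Λ) (_ : IsSimpleModule Λ S1)
    (_ : IsSimpleModule Λ S2) (_ : IsSimpleModule Λ S') (_ : IsSimpleModule Λ S'')
    (h1 : RelS T S1 S') (h2 : RelS T S2 S'') (he : Nonempty (S' ≃ₗ[Λ] S'')) :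
    Nonempty (S1 ≃ₗ[Λ] S2) := by
  obtain ⟨P, J, hPl, hPp, hJl, hJf, hJi, ⟨g, hg⟩, ⟨k, hk⟩, hor⟩ := h1
  obtain ⟨P', J', hPl', hPp', hJl', hJf', hJi', ⟨g', hg'⟩, ⟨k', hk'⟩, hor'⟩ := h2
  obtain ⟨e⟩ := he
  have hnt := IsSimpleModule.nontrivial Λ S'
  obtain ⟨eJ⟩ := inj_unique hJl hJl' hJi hJi' k (k' ∘ₗ e.toLinearMap) hk (hk'.comp e.injective)
  have hPP : Nonempty (P ≃ₗ[Λ] P') := by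
    rcases hor with ⟨⟨eP⟩⟩ | ⟨hn, I, ⟨A, B, i, d, ρ, hr, -, -⟩, hret⟩
    · rcases hor' with ⟨⟨eP'⟩⟩ | ⟨hn', -⟩
      · exact ⟨eP.trans (eJ.trans eP'.symm)⟩
      · exact (hn' (Module.Projective.of_equiv' (eP.trans eJ))).elim
    · rcases hor' with ⟨⟨eP'⟩⟩ | ⟨hn', I', ⟨A', B', i', d', ρ', hr', -, -⟩, hret'⟩
      · exact (hn (Module.Projective.of_equiv' (eP'.trans eJ.symm))).elim
      · exact hr.unique hr' hPl hPl' hn hret ((Ret.of_equiv eJ).trans hret')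
  obtain ⟨eP⟩ := hPP
  exact proj_top hPl hPp g (g' ∘ₗ eP.toLinearMap) hg (hg'.comp eP.surjective)

/-- The cotilting resolution property. -/
def Good (T : Type) [AddCommGroup T] [Module Λ T] (I : Type) [AddCommGroup I] [Module Λ I] :
    Prop :=
  ∃ (C0 C1 : ModuleCat.{0} Λ) (u : C0 →ₗ[Λ] C1) (v : C1 →ₗ[Λ] I),
      InAddOf Λ T C0 ∧ InAddOf Λ T C1 ∧ Injective u ∧ Surjective v ∧
      LinearMap.range u = LinearMap.ker v

section good
variable {I J : Type} [AddCommGroup I] [Module Λ I] [AddCommGroup J] [Module Λ J]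

lemma Good.of_equiv (h : Good (Λ := Λ) T I) (e : I ≃ₗ[Λ] J) : Good (Λ := Λ) T J := by
  obtain ⟨C0, C1, u, v, h0, h1, hu, hv, huv⟩ := h
  refine ⟨C0, C1, u, e.toLinearMap ∘ₗ v, h0, h1, hu, e.surjective.comp hv, ?_⟩
  rw [huv, LinearMap.ker_comp_of_ker_eq_bot _ (LinearMap.ker_eq_bot.2 e.injective)]

lemma Good.prod (h : Good (Λ := Λ) T I) (h' : Good (Λ := Λ) T J) : Good (Λ := Λ) T (I × J) := by
  obtain ⟨C0, C1, u, v, h0, h1, hu, hv, huv⟩ := h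
  obtain ⟨C0', C1', u', v', h0', h1', hu', hv', huv'⟩ := h'
  refine ⟨ModuleCat.of Λ (C0 × C0'), ModuleCat.of Λ (C1 × C1'), u.prodMap u', v.prodMap v',
    inAdd_prod h0 h0', inAdd_prod h1 h1', ?_, ?_, ?_⟩
  · exact Function.Injective.prodMap hu hu'
  · exact Function.Surjective.prodMap hv hv'
  · change LinearMap.range (u.prodMap u') = LinearMap.ker (v.prodMap v')
    rw [LinearMap.range_prodMap, LinearMap.ker_prodMap, huv, huv']

lemma Good.of_add (h : InAddOf Λ T I) : Good (Λ := Λ) T I := by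
  refine ⟨ModuleCat.of Λ PUnit, ModuleCat.of Λ I, 0, LinearMap.id, ?_, h, ?_, fun x => ⟨x, rfl⟩,
    ?_⟩
  · exact inAdd_zero (M := PUnit)
  · intro a b _
    exact Subsingleton.elim (α := PUnit) a b
  · ext x
    simp [eq_comm]

end good

lemma Setup.good_loc [IsArtinianRing Λ] (h : Setup f c j π T) (X : Type) [AddCommGroup X]
    [Module Λ X] (hf : Module.Finite Λ X) (hi : Module.Injective Λ X) (hl : IsLoc Λ X) :
    Good (Λ := Λ) T X := by
  have := hl.1
  obtain ⟨S', hS', k, hk⟩ := exists_simple_sub (Λ := Λ) X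
  obtain ⟨S, S'', hS, hrel, ⟨e⟩⟩ := simple_pigeon (RelS T) h.rel_exists rel_unique S' hS'
  obtain ⟨P, J, hPl, hPp, hJl, hJf, hJi, -, ⟨k', hk'⟩, hor⟩ := hrel
  have hnt := IsSimpleModule.nontrivial Λ S'
  obtain ⟨eJ⟩ := inj_unique hJl hl hJi hi (k' ∘ₗ e.symm.toLinearMap) k
    (hk'.comp e.symm.injective) hk
  refine Good.of_equiv ?_ eJ
  rcases hor with ⟨⟨eP⟩⟩ | ⟨hn, I, ⟨A, B, i, d, ρ, hr, hB, hadd⟩, s, p, hps⟩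
  · exact Good.of_add (h.pinj_add hJf ⟨Module.Projective.of_equiv' eP, hJi⟩)
  · have hBadd := h.pinj_add hB hr.pi1
    refine ⟨ModuleCat.of Λ (LinearMap.ker (p ∘ₗ ρ)), B, (LinearMap.ker (p ∘ₗ ρ)).subtype, p ∘ₗ ρ,
      ?_, hBadd, Submodule.injective_subtype _, ?_, by simp⟩
    · refine inAdd_ret (N := LinearMap.ker ρ × B) ?_ (inAdd_prod hadd hBadd)
      exact ker_ret hr.pi1.1 s p hps ρ hr.surj (LinearMap.ker ρ).subtype
        (Submodule.injective_subtype _) (by simp) (LinearMap.ker (p ∘ₗ ρ)).subtype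
        (Submodule.injective_subtype _) (by simp)
    · have hp : Surjective p := fun x => ⟨s x, LinearMap.congr_fun hps x⟩
      exact hp.comp hr.surj

lemma Setup.good [IsArtinianRing Λ] (h : Setup f c j π T) (X : ModuleCat.{0} Λ)
    (hf : Module.Finite Λ X) (hi : Module.Injective Λ X) : Good (Λ := Λ) T X := by
  by_contra hg
  obtain ⟨J, ⟨⟨hJi, hJf⟩, hJ⟩, hJl, -⟩ := exists_loc' (Λ := Λ)
    (fun M => (Module.Injective Λ M ∧ Module.Finite Λ M) ∧ ¬ Good (Λ := Λ) T M)
    (by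
      rintro M ⟨-, hn⟩
      by_contra hs
      rw [not_nontrivial_iff_subsingleton] at hs
      exact hn (Good.of_add inAdd_zero))
    (by
      rintro M A B hAB ⟨⟨hi, hf⟩, hn⟩
      have rA : Ret Λ A M := Ret.of_isCompl_left hAB
      have rB : Ret Λ B M := Ret.of_isCompl_left hAB.symm
      by_cases hA : Good (Λ := Λ) T A
      · right
        exact ⟨⟨rB.injective hi, rB.finite hf⟩,
          fun hB => hn ((hA.prod hB).of_equiv (Submodule.prodEquivOfIsCompl A B hAB))⟩
      · left
        exact ⟨⟨rA.injective hi, rA.finite hf⟩, hA⟩)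
    X hf ⟨⟨hi, hf⟩, hg⟩
  exact hJ (h.good_loc J hJf hJi hJl)

end setup

lemma ext1_of {W X Y : Type} [AddCommGroup W] [Module Λ W] [AddCommGroup X] [Module Λ X]
    [AddCommGroup Y] [Module Λ Y] (hW : Module.Projective Λ W) (q : W →ₗ[Λ] Y)
    (hq : Surjective q)
    (hx : ∀ φ : LinearMap.ker q →ₗ[Λ] X, ∃ ψ : W →ₗ[Λ] X, ψ ∘ₗ (LinearMap.ker q).subtype = φ) :
    Ext1Vanish Λ Y X := by
  intro E f g hf hg hfg
  have hk : ∀ q, g q = 0 → q ∈ LinearMap.range f := fun q hq => hfg ▸ hq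
  have hz : ∀ x, g (f x) = 0 := fun x => by
    have : f x ∈ LinearMap.ker g := hfg ▸ ⟨x, rfl⟩
    exact this
  obtain ⟨h, hh⟩ := Module.projective_lifting_property g q hg
  have hh' : ∀ x, g (h x) = q x := fun x => LinearMap.congr_fun hh x
  obtain ⟨φ, hφ⟩ := lift_inj f hf (h ∘ₗ (LinearMap.ker q).subtype) (fun z => hk _ (by simp [hh']))
  obtain ⟨ψ, hψ⟩ := hx φ
  obtain ⟨s, hs⟩ := desc_surj q hq (h - f ∘ₗ ψ) (fun x hx => by
    have e1 := LinearMap.congr_fun hφ ⟨x, hx⟩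
    have e2 := LinearMap.congr_fun hψ ⟨x, hx⟩
    simp only [LinearMap.comp_apply, Submodule.subtype_apply] at e1 e2
    simp [e2, e1])
  have hgs : ∀ y, g (s y) = y := fun y => by
    obtain ⟨w, rfl⟩ := hq y
    have := LinearMap.congr_fun hs w
    simp only [LinearMap.comp_apply] at this
    rw [this]
    simp [hh', hz]
  obtain ⟨r, hr⟩ := lift_inj f hf (LinearMap.id - s ∘ₗ g) (fun z => hk _ (by simp [hgs]))
  refine ⟨r, LinearMap.ext fun x => hf ?_⟩
  have := LinearMap.congr_fun hr (f x)
  simp only [LinearMap.comp_apply] at this ⊢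
  rw [this]
  simp [hz]

lemma backward_dir [IsArtinianRing Λ] (hid : idLE Λ 2 Λ) (hdd : DomdimGE2 Λ) :
    ∃ T : ModuleCat.{0} Λ, Module.Finite Λ T ∧ IsTilting Λ T ∧ IsCotilting Λ T ∧ MemC Λ T := by
  obtain ⟨Q0, Q1, f, g, fin0, pi0, fin1, pi1, hf, hfg⟩ := hdd
  have := pi0.1
  let c := (LinearMap.range f).mkQ
  have hc : Surjective c := Submodule.mkQ_surjective _
  have hfc : LinearMap.range f = LinearMap.ker c := by simp [c]
  let j : (Q0 ⧸ LinearMap.range f) →ₗ[Λ] Q1 := (LinearMap.range f).liftQ g hfg.le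
  have hj : Injective j := by
    rw [← LinearMap.ker_eq_bot]
    exact Submodule.ker_liftQ_eq_bot _ _ _ hfg.ge
  let π := (LinearMap.range j).mkQ
  have hπ : Surjective π := Submodule.mkQ_surjective _
  have hjπ : LinearMap.range j = LinearMap.ker π := by simp [π]
  have hI0 : Module.Injective Λ (Q1 ⧸ LinearMap.range j) := by
    have h1 := (idLE_coker f c hf hc hfc pi0.2).2 hid
    exact (idLE_coker j π hj hπ hjπ pi1.2).2 h1
  let T := Q0 × (Q0 ⧸ LinearMap.range f)
  have a0 : InAddOf Λ T Q0 := inAdd_ret Ret.fst inAdd_self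
  have aC : InAddOf Λ T (Q0 ⧸ LinearMap.range f) := inAdd_ret Ret.snd inAdd_self
  have hset : Setup f c j π T :=
    ⟨fin0, fin1, pi0, pi1, hf, hfc, hc, hj, hjπ, hπ, hI0, a0, aC⟩
  let q : (Q0 × Q0) →ₗ[Λ] T := LinearMap.id.prodMap c
  have hq : Surjective q := Function.Surjective.prodMap surjective_id hc
  have hpp : IsProjInj Λ (Q0 × Q0) := pinj_prod pi0 pi0
  let em : Λ →ₗ[Λ] LinearMap.ker q := (LinearMap.inr Λ Q0 Q0 ∘ₗ f).codRestrict _ (fun x => by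
    refine LinearMap.mem_ker.2 (Prod.ext rfl ?_)
    have : f x ∈ LinearMap.ker c := hfc ▸ ⟨x, rfl⟩
    exact this)
  have hem : Bijective em := by
    constructor
    · intro x y hxy
      have h2 : ((em x : LinearMap.ker q) : Q0 × Q0).2 = ((em y : LinearMap.ker q) : Q0 × Q0).2 := by
        rw [hxy]
      exact hf h2
    · rintro ⟨⟨x, y⟩, hxy⟩
      have h1 : x = 0 := congrArg Prod.fst (LinearMap.mem_ker.1 hxy)
      have h2 : y ∈ LinearMap.ker c := congrArg Prod.snd (LinearMap.mem_ker.1 hxy)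
      rw [← hfc] at h2
      obtain ⟨l, rfl⟩ := h2
      subst h1
      exact ⟨l, rfl⟩
  have hkp : Module.Projective Λ (LinearMap.ker q) :=
    Module.Projective.of_equiv' (LinearEquiv.ofBijective em hem)
  have hext : Ext1Vanish Λ T T := by
    refine ext1_of hpp.1 q hq (fun φ => ?_)
    obtain ⟨φ', hφ'⟩ := Module.projective_lifting_property q φ hq
    obtain ⟨ψ, hψ⟩ := inj_ext hpp.2 (LinearMap.ker q).subtype (Submodule.injective_subtype _) φ'
    refine ⟨q ∘ₗ ψ, ?_⟩
    rw [LinearMap.comp_assoc, hψ, hφ']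
  let u : T →ₗ[Λ] (Q0 × Q1) := LinearMap.id.prodMap j
  have hu : Injective u := Function.Injective.prodMap injective_id hj
  have hpu : IsProjInj Λ (Q0 × Q1) := pinj_prod pi0 pi1
  let w : (Q0 × Q1) →ₗ[Λ] (Q1 ⧸ LinearMap.range j) := π ∘ₗ LinearMap.snd _ _ _
  have hw : Surjective w := hπ.comp Prod.snd_surjective
  have huw : LinearMap.range u = LinearMap.ker w := by
    ext ⟨x, y⟩
    have hy : y ∈ LinearMap.range j ↔ π y = 0 := ⟨fun h => hjπ.le h, fun h => hjπ.ge h⟩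
    constructor
    · rintro ⟨⟨a, b⟩, hab⟩
      exact hy.1 ⟨b, congrArg Prod.snd hab⟩
    · intro hxy
      obtain ⟨b, hb⟩ := hy.2 hxy
      exact ⟨(x, b), Prod.ext rfl hb⟩
  have hidT : idLE Λ 1 T := (idLE_coker (n := 0) u w hu hw huw hpu.2).1 hI0
  refine ⟨ModuleCat.of Λ T, inferInstanceAs (Module.Finite Λ (Q0 × (Q0 ⧸ LinearMap.range f))),
    ⟨?_, hext, Q0, ModuleCat.of Λ (Q0 ⧸ LinearMap.range f), f, c, a0, aC, hf, hc, hfc⟩,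
    ⟨hidT, hext, fun I hI hI' => hset.good I hI hI'⟩, ?_, ?_⟩
  · exact ⟨ModuleCat.of Λ (Q0 × Q0), q, hpp.1, inferInstanceAs (Module.Finite Λ (Q0 × Q0)), hq, hkp⟩
  · exact ⟨ModuleCat.of Λ (Q0 × Q0), inferInstanceAs (Module.Finite Λ (Q0 × Q0)), hpp, q, hq⟩
  · exact ⟨ModuleCat.of Λ (Q0 × Q1), inferInstanceAs (Module.Finite Λ (Q0 × Q1)), hpu, u, hu⟩

end Backward

theorem stmt12 (Λ : Type) [Ring Λ] (k : Type) [CommRing k] [IsArtinianRing k] [Algebra k Λ]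
    [Module.Finite k Λ] :
    (∃ T : ModuleCat.{0} Λ, Module.Finite Λ T ∧ IsTilting Λ T ∧ IsCotilting Λ T ∧ MemC Λ T)
    ↔ (idLE Λ 2 Λ ∧ DomdimGE2 Λ) := by
  have : IsArtinianRing Λ := IsArtinianRing.of_finite k Λ
  constructor
  · rintro ⟨T, -, ht, hc, hm⟩
    exact forward_dir T ht hc hm
  · rintro ⟨h1, h2⟩
    exact backward_dir h1 h2
end
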